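/- arXiv:1510.04471 — 3 statements merged into one kernel-verified Lean document; each statement's English description precedes it below -/
import Mathlib

section
/- If X is a reflexive Kadec real Banach space and C ⊆ X is a nonempty closed set, then C is almost proximinal: the set N(C) of points of X that have a nearest point in C contains a dense G_δ subset of X. -/
open Metric Filter Topology

/-- A real normed space is reflexive if the canonical embedding into its double dual
is surjective. -/
def IsReflexiveSpace (X : Type*) [NormedAddCommGroup X] [NormedSpace ℝ X] : Prop :=
  Function.Surjective (NormedSpace.inclusionInDoubleDual ℝ X)

/-- A real normed space is (sequentially) Kadec if every sequence converging weakly to `x`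
whose norms converge to `‖x‖` converges to `x` in norm. -/
def IsKadecSpace (X : Type*) [NormedAddCommGroup X] [NormedSpace ℝ X] : Prop :=
  ∀ (u : ℕ → X) (x : X),
    (∀ f : X →L[ℝ] ℝ, Tendsto (fun n => f (u n)) atTop (𝓝 (f x))) →
    Tendsto (fun n => ‖u n‖) atTop (𝓝 ‖x‖) →
    Tendsto u atTop (𝓝 x)

/-- The set of points of `X` that have a nearest point in `C`. -/
def NearestPoints {X : Type*} [NormedAddCommGroup X] (C : Set X) : Set X :=
  {x | ∃ z ∈ C, ‖x - z‖ = Metric.infDist x C}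

theorem exists_strongDual_ne_zero_of_notMem {E : Type*} [NormedAddCommGroup E] [NormedSpace ℝ E]
    (p : Submodule ℝ E) (hp : IsClosed (p : Set E)) {x : E} (hx : x ∉ p) :
    ∃ f : E →L[ℝ] ℝ, f x ≠ 0 ∧ ∀ y ∈ p, f y = 0 := by
  obtain ⟨f, u, hfu, hux⟩ := geometric_hahn_banach_closed_point p.convex hp hx
  have h0 : ∀ y ∈ p, f y = 0 := by
    intro y hy
    by_contra hne
    have := hfu ((u / f y) • y) (p.smul_mem _ hy)
    rw [map_smul, smul_eq_mul, div_mul_cancel₀ _ hne] at this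
    exact lt_irrefl _ this
  refine ⟨f, ?_, h0⟩
  have := hfu 0 p.zero_mem
  rw [map_zero] at this
  linarith

/-- A closed subspace of a reflexive space is reflexive. -/
theorem IsReflexiveSpace.submodule {X : Type*} [NormedAddCommGroup X] [NormedSpace ℝ X]
    (h : IsReflexiveSpace X) (Y : Submodule ℝ X) (hY : IsClosed (Y : Set X)) :
    IsReflexiveSpace Y := by
  intro F
  let R : (X →L[ℝ] ℝ) →L[ℝ] (Y →L[ℝ] ℝ) := (ContinuousLinearMap.compL ℝ Y X ℝ).flip Y.subtypeL
  obtain ⟨x, hx⟩ := h (F.comp R)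
  have hx' : ∀ f : X →L[ℝ] ℝ, f x = F (f.comp Y.subtypeL) := fun f => by
    rw [← NormedSpace.dual_def ℝ X x f, hx]; rfl
  have hxY : x ∈ Y := by
    by_contra hxY
    obtain ⟨f, hfx, hf⟩ := exists_strongDual_ne_zero_of_notMem Y hY hxY
    apply hfx
    have : f.comp Y.subtypeL = 0 := by
      ext y
      exact hf y y.2
    rw [hx', this, map_zero]
  refine ⟨⟨x, hxY⟩, ?_⟩
  ext g
  obtain ⟨f, hf, -⟩ := exists_extension_norm_eq Y g
  have hg : f.comp Y.subtypeL = g := by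
    ext y
    exact hf y
  rw [NormedSpace.dual_def, ← hg, ← hx']
  rfl

/-- The dual of a separable reflexive space is separable. -/
theorem IsReflexiveSpace.separableSpace_dual {Y : Type*} [NormedAddCommGroup Y] [NormedSpace ℝ Y]
    (h : IsReflexiveSpace Y) [TopologicalSpace.SeparableSpace Y] :
    TopologicalSpace.SeparableSpace (Y →L[ℝ] ℝ) := by
  choose φ hφ1 hφ2 using fun y : Y => exists_dual_vector'' ℝ y
  let S : Set (Y →L[ℝ] ℝ) := Set.range fun n => φ (TopologicalSpace.denseSeq Y n)
  have hS : TopologicalSpace.IsSeparable S := (Set.countable_range _).isSeparable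
  let p : Submodule ℝ (Y →L[ℝ] ℝ) := (Submodule.span ℝ S).topologicalClosure
  have hp : TopologicalSpace.IsSeparable (p : Set (Y →L[ℝ] ℝ)) := hS.span.closure
  have htop : (p : Set (Y →L[ℝ] ℝ)) = Set.univ := by
    rw [Set.eq_univ_iff_forall]
    intro g
    by_contra hg
    obtain ⟨F, hFg, hF⟩ := exists_strongDual_ne_zero_of_notMem p
      (Submodule.isClosed_topologicalClosure _) hg
    obtain ⟨y, rfl⟩ := h F
    apply hFg
    have hy : y = 0 := by
      rw [← norm_le_zero_iff]
      refine le_of_forall_pos_le_add fun ε hε => ?_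
      obtain ⟨n, hn⟩ := (TopologicalSpace.denseRange_denseSeq Y).exists_dist_lt y (half_pos hε)
      set d := TopologicalSpace.denseSeq Y n
      have h0 : φ d y = 0 := by
        rw [← NormedSpace.dual_def ℝ Y y (φ d)]
        exact hF _ (Submodule.le_topologicalClosure _ (Submodule.subset_span ⟨n, rfl⟩))
      have h1 : ‖d‖ ≤ ‖d - y‖ := by
        have h2 : ‖φ d (d - y)‖ ≤ 1 * ‖d - y‖ := (φ d).le_of_opNorm_le (hφ1 d) _
        rw [map_sub, h0, sub_zero, hφ2, one_mul] at h2
        simpa using h2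
      have h3 : ‖y‖ ≤ ‖y - d‖ + ‖d‖ := by simpa using norm_add_le (y - d) d
      rw [dist_eq_norm] at hn
      rw [norm_sub_rev] at h1
      linarith
    rw [hy, map_zero]
    rfl
  rw [htop] at hp
  exact TopologicalSpace.isSeparable_univ_iff.mp hp

theorem exists_subseq_weakStar_tendsto {Z : Type*} [NormedAddCommGroup Z] [NormedSpace ℝ Z]
    [TopologicalSpace.SeparableSpace Z] (u : ℕ → StrongDual ℝ Z) (M : ℝ) (hu : ∀ n, ‖u n‖ ≤ M) :
    ∃ (F : StrongDual ℝ Z) (s : ℕ → ℕ), StrictMono s ∧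
      ∀ z : Z, Tendsto (fun n => u (s n) z) atTop (𝓝 (F z)) := by
  have hw : ∀ n, StrongDual.toWeakDual (u n) ∈ WeakDual.toStrongDual ⁻¹'
      Metric.closedBall (0 : StrongDual ℝ Z) M := fun n => by
    rw [Set.mem_preimage, mem_closedBall_zero_iff]
    exact hu n
  obtain ⟨F, -, s, hs, hF⟩ := WeakDual.isSeqCompact_closedBall ℝ Z 0 M hw
  exact ⟨WeakDual.toStrongDual F, s, hs, fun z =>
    (WeakDual.eval_continuous (𝕜 := ℝ) z).continuousAt.tendsto.comp hF⟩

theorem IsReflexiveSpace.exists_subseq_weakly_tendsto_of_separableSpace {Y : Type*}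
    [NormedAddCommGroup Y] [NormedSpace ℝ Y] [TopologicalSpace.SeparableSpace Y]
    (h : IsReflexiveSpace Y) (u : ℕ → Y) (M : ℝ) (hu : ∀ n, ‖u n‖ ≤ M) :
    ∃ (y : Y) (s : ℕ → ℕ), StrictMono s ∧
      ∀ f : Y →L[ℝ] ℝ, Tendsto (fun n => f (u (s n))) atTop (𝓝 (f y)) := by
  have := h.separableSpace_dual
  obtain ⟨F, s, hs, hF⟩ := exists_subseq_weakStar_tendsto
    (fun n => NormedSpace.inclusionInDoubleDual ℝ Y (u n)) M
    fun n => (NormedSpace.double_dual_bound ℝ Y (u n)).trans (hu n)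
  obtain ⟨y, rfl⟩ := h F
  exact ⟨y, s, hs, hF⟩

/-- Bounded sequences in a reflexive space have weakly convergent subsequences. -/
theorem IsReflexiveSpace.exists_subseq_weakly_tendsto {X : Type*} [NormedAddCommGroup X]
    [NormedSpace ℝ X] (h : IsReflexiveSpace X) (u : ℕ → X) (M : ℝ) (hu : ∀ n, ‖u n‖ ≤ M) :
    ∃ (x : X) (s : ℕ → ℕ), StrictMono s ∧
      ∀ f : X →L[ℝ] ℝ, Tendsto (fun n => f (u (s n))) atTop (𝓝 (f x)) := by
  let Y : Submodule ℝ X := (Submodule.span ℝ (Set.range u)).topologicalClosure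
  have hYc : IsClosed (Y : Set X) := Submodule.isClosed_topologicalClosure _
  have hYs : TopologicalSpace.IsSeparable (Y : Set X) :=
    (Set.countable_range u).isSeparable.span.closure
  have : TopologicalSpace.SeparableSpace Y := hYs.separableSpace
  obtain ⟨y, s, hs, hy⟩ :=
    (h.submodule Y hYc).exists_subseq_weakly_tendsto_of_separableSpace (fun n => ⟨u n,
      Submodule.le_topologicalClosure _ (Submodule.subset_span ⟨n, rfl⟩)⟩) M hu
  exact ⟨y, s, hs, fun f => hy (f.comp Y.subtypeL)⟩

/-- **Ekeland's variational principle**. -/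
theorem exists_ekeland_point {α : Type*} [MetricSpace α] [CompleteSpace α] {F : α → ℝ}
    (hF : Continuous F) (hb : ∀ x, 0 ≤ F x) {ε : ℝ} (hε : 0 < ε) (x₀ : α) :
    ∃ v, F v ≤ F x₀ ∧ ∀ y, F v ≤ F y + ε * dist y v := by
  let S : α → Set α := fun x => {y | F y + ε * dist y x ≤ F x}
  have hself : ∀ x, x ∈ S x := fun x => by simp [S]
  have htrans : ∀ {x y z}, y ∈ S x → z ∈ S y → z ∈ S x := by
    intro x y z hy hz
    simp only [S, Set.mem_ofPred_eq] at *
    have := mul_le_mul_of_nonneg_left (dist_triangle z y x) hε.le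
    linarith
  have hclosed : ∀ x, IsClosed (S x) := fun x =>
    isClosed_le (by fun_prop) continuous_const
  have hstep : ∀ (x : α) (n : ℕ), ∃ y ∈ S x, ∀ z ∈ S x, F y ≤ F z + (1 / 2) ^ n := by
    intro x n
    have hbdd : BddBelow (F '' S x) := ⟨0, by rintro _ ⟨y, -, rfl⟩; exact hb y⟩
    obtain ⟨_, ⟨y, hy, rfl⟩, hlt⟩ := exists_lt_of_csInf_lt (s := F '' S x)
      ⟨_, x, hself x, rfl⟩ (lt_add_of_pos_right _ (by positivity : (0 : ℝ) < (1 / 2) ^ n))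
    refine ⟨y, hy, fun z hz => ?_⟩
    have := csInf_le hbdd ⟨z, hz, rfl⟩
    linarith
  choose next hnext hmin using hstep
  let u : ℕ → α := fun n => Nat.rec x₀ (fun n x => next x n) n
  have hu : ∀ n, u (n + 1) = next (u n) n := fun n => rfl
  have hmem : ∀ n m, n ≤ m → u m ∈ S (u n) := by
    intro n m hnm
    induction m, hnm using Nat.le_induction with
    | base => exact hself _
    | succ m _ ih => exact htrans ih (by rw [hu]; exact hnext _ _)
  have hsmall : ∀ n, ∀ z ∈ S (u (n + 1)), ε * dist z (u (n + 1)) ≤ (1 / 2) ^ n := by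
    intro n z hz
    have h1 := hmin (u n) n z (htrans (hmem n (n + 1) n.le_succ) hz)
    rw [← hu] at h1
    simp only [S, Set.mem_ofPred_eq] at hz
    linarith
  have hpow : Tendsto (fun n : ℕ => (1 / 2 : ℝ) ^ n / ε) atTop (𝓝 0) := by
    simpa using (tendsto_pow_atTop_nhds_zero_of_lt_one (by norm_num : (0 : ℝ) ≤ 1 / 2)
      (by norm_num)).div_const ε
  have hdist : ∀ n, ∀ z ∈ S (u (n + 1)), dist z (u (n + 1)) ≤ (1 / 2) ^ n / ε := by
    intro n z hz
    rw [le_div_iff₀ hε, mul_comm]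
    exact hsmall n z hz
  have hcauchy : CauchySeq fun n => u (n + 1) := by
    refine cauchySeq_of_le_tendsto_0' (fun n : ℕ => (1 / 2 : ℝ) ^ n / ε) ?_ hpow
    intro n m hnm
    rw [dist_comm]
    exact hdist n _ (hmem (n + 1) (m + 1) (by omega))
  obtain ⟨v, hv⟩ := cauchySeq_tendsto_of_complete hcauchy
  have hvS : ∀ n, v ∈ S (u n) := by
    intro n
    refine (hclosed _).mem_of_tendsto hv ?_
    filter_upwards [eventually_ge_atTop n] with m hm
    exact hmem n (m + 1) (by omega)
  refine ⟨v, ?_, fun y => ?_⟩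
  · have h0 : F v + ε * dist v x₀ ≤ F x₀ := hvS 0
    have : 0 ≤ ε * dist v x₀ := by positivity
    linarith
  · by_contra! hlt
    have hyS : y ∈ S v := hlt.le
    have hy : Tendsto (fun n => u (n + 1)) atTop (𝓝 y) := by
      rw [tendsto_iff_dist_tendsto_zero]
      refine squeeze_zero (fun _ => dist_nonneg) (fun n => ?_) hpow
      rw [dist_comm]
      exact hdist n y (htrans (hvS (n + 1)) hyS)
    have : y = v := tendsto_nhds_unique hy hv
    rw [this] at hlt
    simp at hlt

section SmoothBump

variable {Z : Type*} [NormedAddCommGroup Z]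

/-- The weighted sum of squared distances to the terms of the sequence `g`. -/
noncomputable def weightedSqDist (g : ℕ → Z) (f : Z) : ℝ :=
  ∑' n, (1 / 2 : ℝ) ^ n * ‖f - g n‖ ^ 2

theorem weightedSqDist_nonneg (g : ℕ → Z) (f : Z) : 0 ≤ weightedSqDist g f :=
  tsum_nonneg fun n => by positivity

theorem summable_weightedSqDist {g : ℕ → Z} (hg : ∀ n, ‖g n‖ ≤ 1) (f : Z) :
    Summable fun n => (1 / 2 : ℝ) ^ n * ‖f - g n‖ ^ 2 := by
  refine Summable.of_nonneg_of_le (fun n => by positivity) (fun n => ?_)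
    (summable_geometric_two.mul_right ((‖f‖ + 1) ^ 2))
  have h : ‖f - g n‖ ≤ ‖f‖ + 1 := (norm_sub_le _ _).trans (by linarith [hg n])
  gcongr

theorem weightedSqDist_le {g : ℕ → Z} (hg : ∀ n, ‖g n‖ ≤ 1) {f : Z} (hf : ‖f‖ ≤ 1) :
    weightedSqDist g f ≤ 8 := by
  have h : weightedSqDist g f ≤ ∑' n : ℕ, (1 / 2 : ℝ) ^ n * 2 ^ 2 := by
    refine (summable_weightedSqDist hg f).tsum_le_tsum (fun n => ?_)
      (summable_geometric_two.mul_right _)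
    have h : ‖f - g n‖ ≤ 2 := (norm_sub_le _ _).trans (by linarith [hg n])
    gcongr
  rw [tsum_mul_right, tsum_geometric_two] at h
  linarith

variable [NormedSpace ℝ Z]

/-- Quantitative midpoint convexity of `weightedSqDist`. -/
theorem weightedSqDist_midpoint_add_le {g : ℕ → Z} (hg : ∀ n, ‖g n‖ ≤ 1) (f f' : Z) (n : ℕ) :
    weightedSqDist g ((1 / 2 : ℝ) • (f + f')) +
      (1 / 2) ^ n * (‖f - g n‖ - ‖f' - g n‖) ^ 2 / 4 ≤
      (weightedSqDist g f + weightedSqDist g f') / 2 := by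
  let m : Z := (1 / 2 : ℝ) • (f + f')
  have hs := summable_weightedSqDist hg f
  have hs' := summable_weightedSqDist hg f'
  have hm := summable_weightedSqDist hg m
  have hgap : ∀ k, (1 / 2 : ℝ) ^ k * (‖f - g k‖ - ‖f' - g k‖) ^ 2 / 4 ≤
      ((1 / 2 : ℝ) ^ k * ‖f - g k‖ ^ 2 + (1 / 2 : ℝ) ^ k * ‖f' - g k‖ ^ 2) / 2 -
        (1 / 2 : ℝ) ^ k * ‖m - g k‖ ^ 2 := by
    intro k
    have h1 : ‖m - g k‖ ≤ (‖f - g k‖ + ‖f' - g k‖) / 2 := by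
      have : m - g k = (1 / 2 : ℝ) • ((f - g k) + (f' - g k)) := by
        simp only [m]
        module
      rw [this, norm_smul, Real.norm_of_nonneg (by norm_num)]
      linarith [norm_add_le (f - g k) (f' - g k)]
    have h2 : ‖m - g k‖ ^ 2 ≤ ((‖f - g k‖ + ‖f' - g k‖) / 2) ^ 2 := by gcongr
    have h3 := mul_le_mul_of_nonneg_left h2 (by positivity : (0 : ℝ) ≤ (1 / 2) ^ k)
    linarith
  have hsum := ((hs.add hs').div_const 2).sub hm
  have h := hsum.le_tsum n fun k _ => le_trans (by positivity) (hgap k)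
  rw [((hs.add hs').div_const 2).tsum_sub hm, tsum_div_const, hs.tsum_add hs'] at h
  have := (hgap n).trans h
  simp only [weightedSqDist]
  linarith

variable {Y : Type*} [NormedAddCommGroup Y] [NormedSpace ℝ Y]

/-- `weightedSqDist` is weak-* lower semicontinuous, hence its linear perturbations attain their
maximum over the dual unit ball. -/
theorem exists_isMax_eval_sub_weightedSqDist {g : ℕ → StrongDual ℝ Y} (hg : ∀ n, ‖g n‖ ≤ 1)
    (x : Y) : ∃ f : StrongDual ℝ Y, ‖f‖ ≤ 1 ∧ ∀ f' : StrongDual ℝ Y, ‖f'‖ ≤ 1 →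
      f' x - weightedSqDist g f' ≤ f x - weightedSqDist g f := by
  let Ψ : WeakDual ℝ Y → ℝ := fun f => weightedSqDist g (WeakDual.toStrongDual f) - f x
  have hlsc : LowerSemicontinuous Ψ := by
    have hdist : ∀ n, LowerSemicontinuous fun f : WeakDual ℝ Y =>
        ‖WeakDual.toStrongDual f - g n‖ := by
      intro n
      rw [lowerSemicontinuous_iff_isClosed_preimage]
      intro c
      convert WeakDual.isClosed_closedBall (𝕜 := ℝ) (g n) c using 1
      ext f
      simp [dist_eq_norm]
    have hterm : ∀ n, LowerSemicontinuous fun f : WeakDual ℝ Y =>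
        (1 / 2 : ℝ) ^ n * ‖WeakDual.toStrongDual f - g n‖ ^ 2 := by
      intro n f c hc
      have hmono : Continuous fun t : ℝ => (1 / 2 : ℝ) ^ n * (max t 0) ^ 2 := by fun_prop
      set t := ‖WeakDual.toStrongDual f - g n‖ with ht
      have hc' : c < (1 / 2 : ℝ) ^ n * (max t 0) ^ 2 := by
        rwa [max_eq_left (norm_nonneg _)]
      obtain ⟨δ, hδ, hball⟩ := Metric.eventually_nhds_iff.1
        (hmono.continuousAt.eventually (lt_mem_nhds hc'))
      have h1 : c < (1 / 2 : ℝ) ^ n * (max (t - δ / 2) 0) ^ 2 := hball (by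
        rw [Real.dist_eq, sub_sub_cancel_left, abs_neg, abs_of_pos (half_pos hδ)]
        linarith)
      filter_upwards [hdist n f (t - δ / 2) (by linarith)] with f' hf'
      refine h1.trans_le ?_
      have h2 : max (t - δ / 2) 0 ≤ ‖WeakDual.toStrongDual f' - g n‖ :=
        max_le hf'.le (norm_nonneg _)
      gcongr
    have hΨ : LowerSemicontinuous fun f : WeakDual ℝ Y =>
        weightedSqDist g (WeakDual.toStrongDual f) := by
      intro f c hc
      have hs := (summable_weightedSqDist hg (WeakDual.toStrongDual f)).hasSum
      obtain ⟨s, hs⟩ := (hs.eventually (lt_mem_nhds hc)).exists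
      have hsum : LowerSemicontinuous fun f : WeakDual ℝ Y =>
          ∑ n ∈ s, (1 / 2 : ℝ) ^ n * ‖WeakDual.toStrongDual f - g n‖ ^ 2 :=
        lowerSemicontinuous_sum fun n _ => hterm n
      filter_upwards [hsum f c hs] with f' hf'
      exact hf'.trans_le ((summable_weightedSqDist hg _).sum_le_tsum s fun n _ => by positivity)
    exact hΨ.add (WeakDual.eval_continuous x).neg.lowerSemicontinuous
  obtain ⟨f, hf, hmin⟩ := (hlsc.lowerSemicontinuousOn
      (WeakDual.toStrongDual ⁻¹' Metric.closedBall 0 1)).exists_isMinOn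
    ⟨0, by simp⟩ (WeakDual.isCompact_closedBall (𝕜 := ℝ) (0 : StrongDual ℝ Y) 1)
  refine ⟨WeakDual.toStrongDual f, by simpa using hf, fun f' hf' => ?_⟩
  have h1 : Ψ f ≤ Ψ (StrongDual.toWeakDual f') := hmin (by simpa using hf')
  have h2 : weightedSqDist g (WeakDual.toStrongDual f) - (WeakDual.toStrongDual f) x ≤
    weightedSqDist g f' - f' x := h1
  linarith

/-- If the dual is separable, there is a coercive Lipschitz function which is everywhere
Fréchet superdifferentiable. -/
theorem exists_superdifferentiable_coercive [TopologicalSpace.SeparableSpace (StrongDual ℝ Y)] :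
    ∃ φ : Y → ℝ, LipschitzWith 1 φ ∧ φ 0 ≤ 0 ∧ (∀ x, ‖x‖ - 8 ≤ φ x) ∧
      ∀ x, ∃ f : StrongDual ℝ Y, ∀ η > 0, ∃ δ > 0, ∀ h : Y, ‖h‖ ≤ δ →
        φ (x + h) ≤ φ x + f h + η * ‖h‖ := by
  let B : Set (StrongDual ℝ Y) := Metric.closedBall 0 1
  have : Nonempty B := ⟨⟨0, by simp [B]⟩⟩
  have : TopologicalSpace.SeparableSpace B :=
    (TopologicalSpace.IsSeparable.of_separableSpace B).separableSpace
  let g : ℕ → StrongDual ℝ Y := fun n => TopologicalSpace.denseSeq B n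
  have hg : ∀ n, ‖g n‖ ≤ 1 := fun n => by
    simpa only [B, mem_closedBall_zero_iff] using (TopologicalSpace.denseSeq B n).2
  have hdense : ∀ f : StrongDual ℝ Y, ‖f‖ ≤ 1 → ∀ η > 0, ∃ n, ‖f - g n‖ < η := by
    intro f hf η hη
    obtain ⟨n, hn⟩ := (TopologicalSpace.denseRange_denseSeq B).exists_dist_lt
      ⟨f, by simpa [B] using hf⟩ hη
    exact ⟨n, by rwa [Subtype.dist_eq, dist_eq_norm] at hn⟩
  choose m hm1 hm using exists_isMax_eval_sub_weightedSqDist hg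
  let φ : Y → ℝ := fun x => m x x - weightedSqDist g (m x)
  have happ : ∀ f : StrongDual ℝ Y, ‖f‖ ≤ 1 → ∀ x, f x ≤ ‖x‖ := fun f hf x => by
    have := f.le_of_opNorm_le hf x
    rw [one_mul] at this
    exact (le_abs_self _).trans this
  refine ⟨φ, ?_, ?_, fun x => ?_, fun x => ⟨m x, fun η hη => ?_⟩⟩
  · refine LipschitzWith.of_le_add fun x y => ?_
    have h1 := hm y (m x) (hm1 x)
    have h2 := happ (m x) (hm1 x) (x - y)
    rw [map_sub, ← dist_eq_norm] at h2
    simp only [φ]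
    linarith
  · have := weightedSqDist_nonneg g (m 0)
    simp only [φ, map_zero]
    linarith
  · obtain ⟨f, hf, hfx⟩ := exists_dual_vector'' ℝ x
    have h1 := hm x f hf
    have h2 := weightedSqDist_le hg hf
    have h3 : f x = ‖x‖ := hfx
    simp only [φ]
    linarith
  · obtain ⟨n, hn⟩ := hdense (m x) (hm1 x) (η / 3) (by positivity)
    let τ : ℝ := (1 / 2) ^ n * (η / 3) ^ 2 / 2
    have hτ : 0 < τ := by positivity
    have hstrong : ∀ f : StrongDual ℝ Y, ‖f‖ ≤ 1 → φ x - τ ≤ f x - weightedSqDist g f →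
        ‖f - m x‖ ≤ η := by
      intro f hf hfx
      have hmid1 : ‖(1 / 2 : ℝ) • (m x + f)‖ ≤ 1 := by
        rw [norm_smul, Real.norm_of_nonneg (by norm_num)]
        linarith [norm_add_le (m x) f, hm1 x]
      have h1 := hm x _ hmid1
      have h2 := weightedSqDist_midpoint_add_le hg (m x) f n
      have h3 : ((1 / 2 : ℝ) • (m x + f)) x = (m x x + f x) / 2 := by
        simp
        ring
      rw [h3] at h1
      have h4 : (1 / 2 : ℝ) ^ n * (‖m x - g n‖ - ‖f - g n‖) ^ 2 ≤
          (1 / 2 : ℝ) ^ n * (η / 3) ^ 2 := by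
        simp only [φ, τ] at hfx
        linarith
      have h5 := le_of_mul_le_mul_left h4 (by positivity)
      have h6 := abs_le_of_sq_le_sq h5 (by positivity)
      have h7 : ‖f - m x‖ ≤ ‖f - g n‖ + ‖m x - g n‖ := by
        have := norm_sub_le (f - g n) (m x - g n)
        rwa [sub_sub_sub_cancel_right] at this
      linarith [(abs_le.1 h6).1]
    refine ⟨τ / 2, by positivity, fun h hh => ?_⟩
    have hf1 := hm1 (x + h)
    set f := m (x + h) with hf
    have hval : φ (x + h) = f x - weightedSqDist g f + f h := by
      simp only [φ, ← hf, map_add]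
      ring
    have hsub : f h - m x h ≤ ‖f - m x‖ * ‖h‖ :=
      (le_abs_self _).trans ((f - m x).le_opNorm h)
    rw [hval]
    rcases le_or_gt (φ x - τ) (f x - weightedSqDist g f) with hnear | hfar
    · have h1 := mul_le_mul_of_nonneg_right (hstrong f hf1 hnear) (norm_nonneg h)
      have h2 : f x - weightedSqDist g f ≤ φ x := hm x f hf1
      linarith
    · have h1 : ‖f - m x‖ ≤ 2 := (norm_sub_le _ _).trans (by linarith [hm1 x])
      have h2 := mul_le_mul_of_nonneg_right h1 (norm_nonneg h)
      have h3 : 0 ≤ η * ‖h‖ := by positivity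
      linarith

end SmoothBump

/-- Approximate Fréchet subgradients of a nonnegative Lipschitz function exist on a dense set
when the dual is separable. -/
theorem exists_approx_subgradient {Y : Type*} [NormedAddCommGroup Y] [NormedSpace ℝ Y]
    [CompleteSpace Y] [TopologicalSpace.SeparableSpace (StrongDual ℝ Y)] {d : Y → ℝ}
    (hd : LipschitzWith 1 d) (hd0 : ∀ y, 0 ≤ d y) (x₀ : Y) {r ε : ℝ} (hr : 0 < r) (hε : 0 < ε) :
    ∃ v ∈ ball x₀ r, ∃ p : StrongDual ℝ Y, ∃ δ > 0, ∀ h : Y, ‖h‖ ≤ δ →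
      d v + p h - ε * ‖h‖ ≤ d (v + h) := by
  obtain ⟨φ, hφ, hφ0, hφb, hφd⟩ := exists_superdifferentiable_coercive (Y := Y)
  let K : ℝ := (d x₀ + 9) / r
  have hK : 0 < K := div_pos (by linarith [hd0 x₀]) hr
  have hKr : K * r = d x₀ + 9 := div_mul_cancel₀ _ hr.ne'
  have hφc := hφ.continuous
  have hdc := hd.continuous
  obtain ⟨v, hv, hmin⟩ := exists_ekeland_point (F := fun y => d y + φ (K • (y - x₀)) + 8)
    (by fun_prop) (fun y => by
      linarith [hd0 y, hφb (K • (y - x₀)), norm_nonneg (K • (y - x₀))]) (half_pos hε) x₀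
  obtain ⟨f, hf⟩ := hφd (K • (v - x₀))
  obtain ⟨δ, hδ, hfδ⟩ := hf (ε / (2 * K)) (by positivity)
  refine ⟨v, ?_, -(K • f), δ / K, by positivity, fun h hh => ?_⟩
  · simp only [sub_self, smul_zero] at hv
    have h1 := hφb (K • (v - x₀))
    rw [norm_smul, Real.norm_of_nonneg hK.le] at h1
    rw [mem_ball, dist_eq_norm]
    refine lt_of_mul_lt_mul_left ?_ hK.le
    linarith [hd0 v]
  · have h1 := hmin (v + h)
    have hn : ‖K • h‖ = K * ‖h‖ := by rw [norm_smul, Real.norm_of_nonneg hK.le]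
    have h2 := hfδ (K • h) (by rw [hn]; rwa [le_div_iff₀ hK, mul_comm] at hh)
    have h3 : K • (v - x₀) + K • h = K • (v + h - x₀) := by module
    have h4 : ε / (2 * K) * (K * ‖h‖) = ε / 2 * ‖h‖ := by
      field_simp
    rw [h3, hn, h4, map_smul, smul_eq_mul] at h2
    rw [dist_eq_norm, add_sub_cancel_left] at h1
    change d v + -(K * f h) - ε * ‖h‖ ≤ d (v + h)
    linarith

/-- Every countable-valued map is captured, on a dense subset, by a separable closed subspace. -/
theorem exists_separable_closed_submodule {X : Type*} [NormedAddCommGroup X] [NormedSpace ℝ X]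
    (F : X → Set X) (hF : ∀ x, (F x).Countable) (x₀ : X) :
    ∃ Y : Submodule ℝ X, IsClosed (Y : Set X) ∧ TopologicalSpace.IsSeparable (Y : Set X) ∧
      x₀ ∈ Y ∧ ∀ y ∈ Y, ∀ η > 0, ∃ y' ∈ Y, ‖y - y'‖ < η ∧ F y' ⊆ Y := by
  let step : Set X → Set X := fun S =>
    S ∪ (⋃ y ∈ S, F y) ∪ Set.image2 (· + ·) S S ∪ ⋃ q : ℚ, (fun y => (q : ℝ) • y) '' S
  let S : ℕ → Set X := fun n => step^[n] {x₀}
  have hS : ∀ n, S (n + 1) = step (S n) := fun n => Function.iterate_succ_apply' step n _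
  have hcount : ∀ n, (S n).Countable := by
    intro n
    induction n with
    | zero => exact Set.countable_singleton x₀
    | succ n ih =>
      rw [hS]
      exact ((ih.union (ih.biUnion fun y _ => hF y)).union (ih.image2 ih _)).union
        (Set.countable_iUnion fun q => ih.image _)
  have hmono : Monotone S := monotone_nat_of_le_succ fun n y hy => by
    rw [hS]
    exact Or.inl (Or.inl (Or.inl hy))
  let D : Set X := ⋃ n, S n
  have hDF : ∀ y ∈ D, F y ⊆ D := by
    intro y hy z hz
    obtain ⟨n, hn⟩ := Set.mem_iUnion.1 hy
    refine Set.mem_iUnion.2 ⟨n + 1, ?_⟩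
    rw [hS]
    exact Or.inl (Or.inl (Or.inr (Set.mem_biUnion hn hz)))
  have hDadd : ∀ y ∈ D, ∀ z ∈ D, y + z ∈ D := by
    intro y hy z hz
    obtain ⟨n, hn⟩ := Set.mem_iUnion.1 hy
    obtain ⟨m, hm⟩ := Set.mem_iUnion.1 hz
    refine Set.mem_iUnion.2 ⟨max n m + 1, ?_⟩
    rw [hS]
    exact Or.inl (Or.inr (Set.mem_image2_of_mem (hmono (le_max_left n m) hn)
      (hmono (le_max_right n m) hm)))
  have hDsmul : ∀ q : ℚ, ∀ y ∈ D, (q : ℝ) • y ∈ D := by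
    intro q y hy
    obtain ⟨n, hn⟩ := Set.mem_iUnion.1 hy
    refine Set.mem_iUnion.2 ⟨n + 1, ?_⟩
    rw [hS]
    exact Or.inr (Set.mem_iUnion.2 ⟨q, Set.mem_image_of_mem _ hn⟩)
  have hx₀ : x₀ ∈ D := Set.mem_iUnion.2 ⟨0, rfl⟩
  let Y : Submodule ℝ X :=
    { carrier := closure D
      add_mem' := fun ha hb => map_mem_closure₂ continuous_add ha hb hDadd
      zero_mem' := subset_closure (by simpa using hDsmul 0 x₀ hx₀)
      smul_mem' := fun c y hy => map_mem_closure₂ (s := Set.range ((↑) : ℚ → ℝ)) continuous_smul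
        (Rat.denseRange_cast c) hy (by
          rintro _ ⟨q, rfl⟩ z hz
          exact hDsmul q z hz) }
  refine ⟨Y, isClosed_closure, (Set.countable_iUnion hcount).isSeparable.closure,
    subset_closure hx₀, fun y hy η hη => ?_⟩
  obtain ⟨y', hy', hlt⟩ := Metric.mem_closure_iff.1 hy η hη
  exact ⟨y', subset_closure hy', by rwa [← dist_eq_norm], (hDF y' hy').trans subset_closure⟩

/-- The points `x` for which the convex hull of the almost nearest points of `C` stays at distance
more than `infDist x C - ε` from `x`. -/
def farHullPoints {X : Type*} [NormedAddCommGroup X] [NormedSpace ℝ X] (C : Set X) (ε : ℝ) :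
    Set X :=
  {x | ∃ δ > 0, ∀ w ∈ convexHull ℝ (C ∩ closedBall x (infDist x C + δ)),
    infDist x C - ε + δ ≤ ‖x - w‖}

section

variable {X : Type*} [NormedAddCommGroup X] [NormedSpace ℝ X]

theorem isOpen_farHullPoints (C : Set X) (ε : ℝ) : IsOpen (farHullPoints C ε) := by
  rw [Metric.isOpen_iff]
  rintro x ⟨δ, hδ, hx⟩
  refine ⟨δ / 4, by positivity, fun y hy => ⟨δ / 4, by positivity, fun w hw => ?_⟩⟩
  rw [mem_ball] at hy
  have h1 : infDist y C ≤ infDist x C + dist y x := infDist_le_infDist_add_dist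
  have hsub : C ∩ closedBall y (infDist y C + δ / 4) ⊆ C ∩ closedBall x (infDist x C + δ) :=
    Set.inter_subset_inter_right _ (closedBall_subset_closedBall' (by linarith))
  have h2 := hx w (convexHull_mono hsub hw)
  have h3 : ‖x - w‖ ≤ dist y x + ‖y - w‖ := by
    rw [← dist_eq_norm, ← dist_eq_norm, dist_comm y x]
    exact dist_triangle _ _ _
  linarith

theorem mem_nearestPoints_of_forall_farHullPoints (hrefl : IsReflexiveSpace X)
    (hkadec : IsKadecSpace X) {C : Set X} (hC : IsClosed C) (hCne : C.Nonempty) {x : X}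
    (hx : ∀ n : ℕ, x ∈ farHullPoints C (1 / (n + 1))) : x ∈ NearestPoints C := by
  have hlim : Tendsto (fun n : ℕ => infDist x C + 1 / ((n : ℝ) + 1)) atTop (𝓝 (infDist x C)) := by
    simpa using tendsto_one_div_add_atTop_nhds_zero_nat.const_add (infDist x C)
  have hz : ∀ n : ℕ, ∃ z ∈ C, dist x z < infDist x C + 1 / ((n : ℝ) + 1) := fun n =>
    (infDist_lt_iff hCne).1 (lt_add_of_pos_right _ Nat.one_div_pos_of_nat)
  choose z hzC hzd using hz
  have hnorm : Tendsto (fun n => ‖x - z n‖) atTop (𝓝 (infDist x C)) := by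
    refine tendsto_of_tendsto_of_tendsto_of_le_of_le tendsto_const_nhds hlim (fun n => ?_)
      fun n => ?_
    · rw [← dist_eq_norm]
      exact infDist_le_dist_of_mem (hzC n)
    · rw [← dist_eq_norm]
      exact (hzd n).le
  obtain ⟨M, hM⟩ := hnorm.bddAbove_range
  obtain ⟨y, s, hs, hy⟩ := hrefl.exists_subseq_weakly_tendsto (fun n => x - z n) M
    fun n => hM ⟨n, rfl⟩
  have hnorm' := hnorm.comp hs.tendsto_atTop
  have hle : ‖y‖ ≤ infDist x C := by
    obtain ⟨f, hf, hfy⟩ := exists_dual_vector'' ℝ y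
    have hfy' : f y = ‖y‖ := hfy
    rw [← hfy']
    refine le_of_tendsto_of_tendsto' (hy f) hnorm' fun n => ?_
    have h := f.le_of_opNorm_le hf (x - z (s n))
    rw [one_mul] at h
    exact (le_abs_self _).trans h
  have hge : infDist x C ≤ ‖y‖ := by
    refine le_of_forall_pos_le_add fun ε hε => ?_
    obtain ⟨n, hn⟩ := exists_nat_one_div_lt hε
    obtain ⟨δ, hδ, hfar⟩ := hx n
    by_contra! hlt
    have hdisj : Disjoint (ball x (infDist x C - 1 / (n + 1) + δ))
        (convexHull ℝ (C ∩ closedBall x (infDist x C + δ))) := by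
      rw [Set.disjoint_left]
      intro w hw hw'
      have := hfar w hw'
      rw [mem_ball', dist_eq_norm] at hw
      linarith
    obtain ⟨f, u, hfu, huf⟩ := geometric_hahn_banach_open (convex_ball _ _) isOpen_ball
      (convex_convexHull ℝ _) hdisj
    have hmem : ∀ᶠ k in atTop, u ≤ f x - f (x - z (s k)) := by
      filter_upwards [hnorm'.eventually (gt_mem_nhds (lt_add_of_pos_right (infDist x C) hδ))]
        with k hk
      rw [← map_sub, sub_sub_cancel]
      refine huf _ (subset_convexHull ℝ _ ⟨hzC _, ?_⟩)
      rw [mem_closedBall', dist_eq_norm]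
      exact hk.le
    have h1 := ge_of_tendsto ((hy f).const_sub (f x)) hmem
    have h2 := hfu (x - y) (by
      rw [mem_ball', dist_eq_norm, sub_sub_cancel]
      linarith)
    rw [map_sub] at h2
    linarith
  have heq := le_antisymm hle hge
  have hconv : Tendsto (fun n => x - z (s n)) atTop (𝓝 y) := by
    refine hkadec _ y hy ?_
    rw [heq]
    exact hnorm'
  have hconv' : Tendsto (fun n => z (s n)) atTop (𝓝 (x - y)) := by
    simpa using hconv.const_sub x
  exact ⟨x - y, hC.mem_of_tendsto hconv' (Eventually.of_forall fun n => hzC _), by simpa using heq⟩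

/-- At an approximate Fréchet subgradient of the distance function, the convex hull of the almost
nearest points cannot be close. -/
theorem false_of_subgradient_of_near_hull {Y : Type*} [NormedAddCommGroup Y] [NormedSpace ℝ Y]
    {C : Set Y} {d : Y → ℝ} (hd : LipschitzWith 1 d) (hd0 : ∀ y, 0 ≤ d y)
    (hdC : ∀ y, ∀ z ∈ C, d y ≤ ‖y - z‖) {v : Y} {M ε δ : ℝ} (hM : 0 < M) (hε : 0 < ε)
    (hδ : 0 < δ) (hvM : d v ≤ M) (p : StrongDual ℝ Y)
    (hp : ∀ h : Y, ‖h‖ ≤ δ → d v + p h - ε / (4 * M) * ‖h‖ ≤ d (v + h))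
    (hnear : ∀ s > 0, ∃ w ∈ convexHull ℝ {z | z ∈ C ∧ ‖v - z‖ ≤ d v + s},
      ‖v - w‖ ≤ d v - ε + s) : False := by
  set ε' : ℝ := ε / (4 * M) with hε'
  have hε'0 : 0 < ε' := by positivity
  have hε'M : ε' * M = ε / 4 := by
    rw [hε']
    field_simp
  have hpbound : ∀ h, p h ≤ (1 + ε') * ‖h‖ := by
    intro h
    rcases eq_or_ne h 0 with rfl | hh
    · simp
    have hh' : 0 < ‖h‖ := norm_pos_iff.2 hh
    have hnorm : ‖(δ / ‖h‖) • h‖ = δ := by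
      rw [norm_smul, Real.norm_of_nonneg (by positivity), div_mul_cancel₀ _ hh'.ne']
    have h1 := hp _ hnorm.le
    have h2 := hd.le_add_mul (v + (δ / ‖h‖) • h) v
    rw [dist_eq_norm, add_sub_cancel_left, hnorm, NNReal.coe_one, one_mul] at h2
    rw [hnorm, map_smul, smul_eq_mul] at h1
    have h3 : δ / ‖h‖ * p h ≤ δ / ‖h‖ * ((1 + ε') * ‖h‖) := by
      have : δ / ‖h‖ * ((1 + ε') * ‖h‖) = (1 + ε') * δ := by field_simp
      rw [this]
      linarith
    exact le_of_mul_le_mul_left h3 (by positivity)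
  have hv0 := hd0 v
  let t : ℝ := min 1 (δ / (d v + 1))
  have ht : 0 < t := by positivity
  have ht1 : t ≤ 1 := min_le_left _ _
  have htδ : t * (d v + 1) ≤ δ := by
    rw [← le_div_iff₀ (by positivity)]
    exact min_le_right _ _
  let s : ℝ := min 1 (min (M / 4) (t * (ε / 8)))
  have hs : 0 < s := by positivity
  have hs1 : s ≤ 1 := min_le_left _ _
  have hsM : s ≤ M / 4 := (min_le_right _ _).trans (min_le_left _ _)
  have hst : s ≤ t * (ε / 8) := (min_le_right _ _).trans (min_le_right _ _)
  obtain ⟨w, hw, hwv⟩ := hnear s hs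
  have hsub : {z | z ∈ C ∧ ‖v - z‖ ≤ d v + s} ⊆
      {z | p z ≤ p v - ((1 - ε') * (d v + s) - ε / 8)} := by
    rintro z ⟨hzC, hz⟩
    have hh : ‖t • (z - v)‖ = t * ‖v - z‖ := by
      rw [norm_smul, Real.norm_of_nonneg ht.le, norm_sub_rev]
    have h1 := hp (t • (z - v)) (by
      rw [hh]
      exact (mul_le_mul_of_nonneg_left (by linarith) ht.le).trans htδ)
    have h2 := hdC (v + t • (z - v)) z hzC
    have h3 : v + t • (z - v) - z = (1 - t) • (v - z) := by module
    rw [h3, norm_smul, Real.norm_of_nonneg (by linarith)] at h2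
    have h4 := mul_le_mul_of_nonneg_left hz (by linarith : 0 ≤ 1 - t)
    have h5 := mul_le_mul_of_nonneg_left hz (by positivity : 0 ≤ ε' * t)
    rw [hh, map_smul, map_sub, smul_eq_mul] at h1
    have h6 : t * p z ≤ t * (p v - ((1 - ε') * (d v + s) - ε / 8)) := by linarith
    exact le_of_mul_le_mul_left h6 ht
  have hpw : p w ≤ p v - ((1 - ε') * (d v + s) - ε / 8) :=
    convexHull_min hsub (convex_halfSpace_le p.toLinearMap.isLinear _) hw
  have h1 := hpbound (v - w)
  rw [map_sub] at h1
  have h2 := mul_le_mul_of_nonneg_left hwv (by positivity : 0 ≤ 1 + ε')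
  have h3 := mul_le_mul_of_nonneg_left (add_le_add hvM hsM) hε'0.le
  have h4 : 0 < ε' * ε := by positivity
  linarith

theorem dense_farHullPoints [CompleteSpace X] (hrefl : IsReflexiveSpace X) (C : Set X) {ε : ℝ}
    (hε : 0 < ε) : Dense (farHullPoints C ε) := by
  rw [Metric.dense_iff]
  intro x₀ r hr
  by_contra hempty
  have hbad : ∀ (x : X) (k : ℕ), ∃ t : Finset X, x ∈ ball x₀ r →
      (t : Set X) ⊆ C ∩ closedBall x (infDist x C + 1 / (k + 1)) ∧
      ∃ w ∈ convexHull ℝ (t : Set X), ‖x - w‖ < infDist x C - ε + 1 / (k + 1) := by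
    intro x k
    by_cases hx : x ∈ ball x₀ r
    · have hxn : x ∉ farHullPoints C ε := fun h => hempty ⟨x, hx, h⟩
      simp only [farHullPoints, Set.mem_ofPred_eq, not_exists, not_and, not_forall, not_le] at hxn
      obtain ⟨w, hw, hlt⟩ := hxn (1 / (k + 1)) Nat.one_div_pos_of_nat
      rw [convexHull_eq_union_convexHull_finite_subsets] at hw
      simp only [Set.mem_iUnion] at hw
      obtain ⟨t, ht, hwt⟩ := hw
      exact ⟨t, fun _ => ⟨ht, w, hwt, hlt⟩⟩
    · exact ⟨∅, fun h => absurd h hx⟩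
  choose T hT using hbad
  obtain ⟨Y, hYc, hYs, hx₀, hYF⟩ := exists_separable_closed_submodule
    (fun x => ⋃ k, (T x k : Set X))
    (fun x => Set.countable_iUnion fun k => (T x k).countable_toSet) x₀
  have : CompleteSpace Y := hYc.completeSpace_coe
  have : TopologicalSpace.SeparableSpace Y := hYs.separableSpace
  have : TopologicalSpace.SeparableSpace (StrongDual ℝ Y) :=
    (hrefl.submodule Y hYc).separableSpace_dual
  have hM : 0 < infDist x₀ C + r := by linarith [infDist_nonneg (x := x₀) (s := C)]
  let d : Y → ℝ := fun y => infDist (y : X) C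
  have hd : LipschitzWith 1 d := LipschitzWith.of_le_add fun y z => infDist_le_infDist_add_dist
  obtain ⟨v, hv, p, δ, hδ, hp⟩ := exists_approx_subgradient hd (fun y => infDist_nonneg)
    ⟨x₀, hx₀⟩ hr (by positivity : 0 < ε / (4 * (infDist x₀ C + r)))
  have hvx : dist (v : X) x₀ < r := hv
  have hvM : d v ≤ infDist x₀ C + r := by
    have : infDist (v : X) C ≤ infDist x₀ C + dist (v : X) x₀ := infDist_le_infDist_add_dist
    simp only [d]
    linarith
  refine false_of_subgradient_of_near_hull (C := {z : Y | (z : X) ∈ C}) hd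
    (fun y => infDist_nonneg) (fun y z hz => ?_) hM hε hδ hvM p hp fun s hs => ?_
  · rw [← dist_eq_norm]
    exact infDist_le_dist_of_mem (x := (y : X)) hz
  · obtain ⟨y, hyY, hy, hTY⟩ := hYF v v.2 (min (s / 4) (r - dist (v : X) x₀))
      (lt_min (by positivity) (by linarith))
    obtain ⟨hys, hyr⟩ := lt_min_iff.1 hy
    rw [← dist_eq_norm] at hys hyr
    obtain ⟨k, hk⟩ := exists_nat_one_div_lt (by positivity : 0 < s / 4)
    have hyball : y ∈ ball x₀ r := by
      rw [mem_ball]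
      linarith [dist_triangle_left y x₀ v]
    obtain ⟨hsub, w, hw, hwy⟩ := hT y k hyball
    have hyd : infDist y C ≤ infDist (v : X) C + dist (v : X) y := by
      rw [dist_comm]
      exact infDist_le_infDist_add_dist
    have hsub' : (T y k : Set X) ⊆
        Y.subtype '' {z : Y | (z : X) ∈ C ∧ ‖v - z‖ ≤ d v + s} := by
      intro z hz
      obtain ⟨hzC, hzy⟩ := hsub hz
      refine ⟨⟨z, hTY (Set.mem_iUnion.2 ⟨k, hz⟩)⟩, ⟨hzC, ?_⟩, rfl⟩
      change ‖(v : X) - z‖ ≤ infDist (v : X) C + s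
      rw [← dist_eq_norm]
      rw [mem_closedBall'] at hzy
      linarith [dist_triangle (v : X) y z]
    have hw' := convexHull_mono hsub' hw
    rw [← LinearMap.image_convexHull] at hw'
    obtain ⟨w', hw', rfl⟩ := hw'
    refine ⟨w', hw', ?_⟩
    change ‖(v : X) - w'‖ ≤ infDist (v : X) C - ε + s
    rw [← dist_eq_norm] at hwy ⊢
    have : dist (v : X) w' ≤ dist (v : X) y + dist y (w' : X) := dist_triangle _ _ _
    simp only [Submodule.subtype_apply] at hwy
    linarith

end

/-- If `X` is a reflexive Kadec real Banach space and `C` is a nonempty closed subset,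
then `C` is almost proximinal: `N(C)` contains a dense `Gδ` subset of `X`. -/
theorem almost_proximinal_of_reflexive_kadec
    (X : Type*) [NormedAddCommGroup X] [NormedSpace ℝ X] [CompleteSpace X]
    (hrefl : IsReflexiveSpace X) (hkadec : IsKadecSpace X)
    (C : Set X) (hCclosed : IsClosed C) (hCne : C.Nonempty) :
    ∃ S : Set X, S ⊆ NearestPoints C ∧ IsGδ S ∧ Dense S := by
  refine ⟨⋂ n : ℕ, farHullPoints C (1 / (n + 1)), fun x hx => ?_, ?_, ?_⟩
  · exact mem_nearestPoints_of_forall_farHullPoints hrefl hkadec hCclosed hCne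
      (Set.mem_iInter.1 hx)
  · exact IsGδ.iInter_of_isOpen fun n => isOpen_farHullPoints C _
  · exact dense_iInter_of_isOpen (fun n => isOpen_farHullPoints C _) fun n =>
      dense_farHullPoints hrefl C Nat.one_div_pos_of_nat
end

section
/- If a real Banach space X is not both reflexive and Kadec, then there exist a nonempty closed set C ⊆ X and a nonempty open set U ⊆ X\C such that no point x ∈ U has a nearest point in C. -/
open Metric Filter Topology

open NormedSpace

/-- **Ekeland's variational principle** for a continuous linear functional on a closed bounded
set: the functional has a maximizer up to a perturbation of slope `ε`. -/
theorem exists_forall_eq_of_add_mul_norm_sub_le {Y : Type*} [NormedAddCommGroup Y]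
    [NormedSpace ℝ Y] [CompleteSpace Y] (g : Y →L[ℝ] ℝ) {B : Set Y} (hB : IsClosed B)
    (hBg : BddAbove (g '' B)) (hne : B.Nonempty) {ε : ℝ} (hε : 0 < ε) :
    ∃ w ∈ B, ∀ z ∈ B, g w + ε * ‖z - w‖ ≤ g z → z = w := by
  let S : Y → Set Y := fun y => {z ∈ B | g y + ε * ‖z - y‖ ≤ g z}
  have hself : ∀ y ∈ B, y ∈ S y := fun y hy => ⟨hy, by simp⟩
  have htrans : ∀ {a b c}, b ∈ S a → c ∈ S b → c ∈ S a := by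
    rintro a b c ⟨-, hab⟩ ⟨hc, hbc⟩
    refine ⟨hc, ?_⟩
    have h1 := norm_sub_le_norm_sub_add_norm_sub c b a
    nlinarith
  have hstep : ∀ y : B, ∃ y' : B, (y' : Y) ∈ S y ∧ ∀ z ∈ S y, g z ≤ 2 * g y' - g y := by
    rintro ⟨y, hy⟩
    have hbdd : BddAbove (g '' S y) := hBg.mono (Set.image_mono fun z hz => hz.1)
    have hle : ∀ z ∈ S y, g z ≤ sSup (g '' S y) := fun z hz => le_csSup hbdd ⟨z, hz, rfl⟩
    rcases (hle y (hself y hy)).eq_or_lt with heq | hlt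
    · refine ⟨⟨y, hy⟩, hself y hy, fun z hz => ?_⟩
      have := hle z hz
      simp only
      linarith
    · obtain ⟨_, ⟨y', hy', rfl⟩, hlt'⟩ :=
        exists_lt_of_lt_csSup (⟨_, y, hself y hy, rfl⟩ : (g '' S y).Nonempty)
          (show (g y + sSup (g '' S y)) / 2 < sSup (g '' S y) by linarith)
      refine ⟨⟨y', hy'.1⟩, hy', fun z hz => ?_⟩
      have := hle z hz
      simp only
      linarith
  choose F hFS hF using hstep
  obtain ⟨b, hb⟩ := hne
  let s : ℕ → B := fun n => F^[n] ⟨b, hb⟩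
  have hs : ∀ n, s (n + 1) = F (s n) := fun n => Function.iterate_succ_apply' F n _
  have hmem : ∀ n m, n ≤ m → (s m : Y) ∈ S (s n) := by
    intro n m hnm
    induction m, hnm using Nat.le_induction with
    | base => exact hself _ (s n).2
    | succ m _ ih => exact htrans ih (hs m ▸ hFS (s m))
  have hmono : Monotone fun n => g (s n) := fun n m hnm => by
    have h1 := (hmem n m hnm).2
    have h2 := mul_nonneg hε.le (norm_nonneg ((s m : Y) - s n))
    linarith
  obtain ⟨L, hL⟩ : ∃ L, Tendsto (fun n => g (s n)) atTop (𝓝 L) := by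
    refine ⟨_, tendsto_atTop_ciSup hmono (hBg.mono ?_)⟩
    rintro _ ⟨n, rfl⟩
    exact ⟨s n, (s n).2, rfl⟩
  have hcauchy : CauchySeq fun n => (s n : Y) := by
    refine cauchySeq_of_le_tendsto_0' (fun n => ε⁻¹ * (L - g (s n))) (fun n m hnm => ?_) ?_
    · have h1 := (hmem n m hnm).2
      have h2 := hmono.ge_of_tendsto hL m
      rw [dist_comm, dist_eq_norm, ← div_eq_inv_mul, le_div_iff₀ hε]
      linarith
    · simpa using (hL.const_sub L).const_mul ε⁻¹
  obtain ⟨w, hw⟩ := cauchySeq_tendsto_of_complete hcauchy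
  have hgw : Tendsto (fun n => g (s n)) atTop (𝓝 (g w)) := (g.continuous.tendsto w).comp hw
  have hwB : w ∈ B := hB.mem_of_tendsto hw (Eventually.of_forall fun n => (s n).2)
  have hwS : ∀ n, w ∈ S (s n) := fun n => by
    refine ⟨hwB, le_of_tendsto_of_tendsto
      (((hw.sub_const _).norm.const_mul ε).const_add (g (s n))) hgw ?_⟩
    filter_upwards [eventually_ge_atTop n] with m hm using (hmem n m hm).2
  refine ⟨w, hwB, fun z hz hzw => ?_⟩
  have hzle : ∀ n, g z ≤ 2 * g (s (n + 1)) - g (s n) := fun n => by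
    rw [hs]
    exact hF (s n) z (htrans (hwS n) ⟨hz, hzw⟩)
  have hlim : Tendsto (fun n => 2 * g (s (n + 1)) - g (s n)) atTop (𝓝 (2 * g w - g w)) :=
    (((tendsto_add_atTop_iff_nat 1).2 hgw).const_mul 2).sub hgw
  have hgz : g z ≤ 2 * g w - g w := ge_of_tendsto' hlim hzle
  have h0 : ‖z - w‖ ≤ 0 := by
    by_contra! hpos
    have := mul_pos hε hpos
    linarith
  exact sub_eq_zero.1 (norm_le_zero_iff.1 h0)

/-- **Bishop–Phelps theorem**: the functionals attaining their supremum on a nonempty closed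
convex set are dense among those that are bounded above on it. -/
theorem exists_norm_sub_le_and_isMaxOn {Y : Type*} [NormedAddCommGroup Y] [NormedSpace ℝ Y]
    [CompleteSpace Y] (g : Y →L[ℝ] ℝ) {B : Set Y} (hB : IsClosed B) (hBc : Convex ℝ B)
    (hBg : BddAbove (g '' B)) (hne : B.Nonempty) {ε : ℝ} (hε : 0 < ε) :
    ∃ k : Y →L[ℝ] ℝ, ‖g - k‖ ≤ ε ∧ ∃ w ∈ B, ∀ y ∈ B, k y ≤ k w := by
  obtain ⟨w, hwB, hw⟩ := exists_forall_eq_of_add_mul_norm_sub_le g hB hBg hne hε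
  let P : Set (Y × ℝ) := {p | ε * ‖p.1‖ < p.2}
  let Q : Set (Y × ℝ) := {p | w + p.1 ∈ B ∧ p.2 ≤ g p.1}
  have hPo : IsOpen P := isOpen_lt (by fun_prop) (by fun_prop)
  have hPc : Convex ℝ P := by
    rintro ⟨x, s⟩ hx ⟨y, t⟩ hy a b ha hb hab
    simp only [P, Set.mem_ofPred_eq, Prod.smul_mk, Prod.mk_add_mk, smul_eq_mul] at hx hy ⊢
    have h1 : ‖a • x + b • y‖ ≤ a * ‖x‖ + b * ‖y‖ := by
      refine (norm_add_le _ _).trans_eq ?_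
      rw [norm_smul, norm_smul, Real.norm_of_nonneg ha, Real.norm_of_nonneg hb]
    have h2 : ε * ‖a • x + b • y‖ ≤ a * (ε * ‖x‖) + b * (ε * ‖y‖) := by
      have := mul_le_mul_of_nonneg_left h1 hε.le
      linarith
    rcases ha.eq_or_lt with rfl | ha'
    · obtain rfl : b = 1 := by linarith
      linarith
    · have h3 := mul_lt_mul_of_pos_left hx ha'
      have h4 := mul_le_mul_of_nonneg_left hy.le hb
      linarith
  have hQc : Convex ℝ Q := by
    rintro ⟨x, s⟩ ⟨hxB, hx⟩ ⟨y, t⟩ ⟨hyB, hy⟩ a b ha hb hab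
    refine ⟨?_, ?_⟩
    · have := hBc hxB hyB ha hb hab
      convert this using 1
      simp only [Prod.smul_mk, Prod.mk_add_mk, smul_add]
      rw [add_add_add_comm, ← add_smul, hab, one_smul]
    · simp only [Prod.smul_mk, Prod.mk_add_mk, smul_eq_mul, map_add, map_smul] at hx hy ⊢
      have h1 := mul_le_mul_of_nonneg_left hx ha
      have h2 := mul_le_mul_of_nonneg_left hy hb
      linarith
  have hdisj : Disjoint P Q := by
    rw [Set.disjoint_left]
    rintro ⟨x, s⟩ hP ⟨hxB, hx⟩
    simp only [P, Set.mem_ofPred_eq] at hP hx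
    have h0 : w + x = w := hw _ hxB (by
      rw [add_sub_cancel_left, map_add]
      linarith)
    obtain rfl : x = 0 := by simpa using h0
    simp at hP hx
    linarith
  obtain ⟨φ, u, hφP, hφQ⟩ := geometric_hahn_banach_open hPc hPo hQc hdisj
  let l : Y →L[ℝ] ℝ := φ.comp (ContinuousLinearMap.inl ℝ Y ℝ)
  have hφ : ∀ y t, φ (y, t) = l y + t * φ (0, 1) := fun y t => by
    have : (y, t) = (y, (0 : ℝ)) + t • ((0 : Y), (1 : ℝ)) := by simp
    rw [this, map_add, map_smul]
    rfl
  have hu0 : u ≤ 0 := by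
    have h1 := hφQ (0, 0) ⟨by simpa using hwB, by simp⟩
    rwa [show ((0 : Y), (0 : ℝ)) = 0 from rfl, map_zero] at h1
  set c := φ (0, 1) with hc
  have hc0 : c < 0 := (hφP (0, 1) (by simp [P])).trans_le hu0
  have hu : 0 ≤ u := by
    by_contra! hneg
    have h1 := hφP (0, u / c / 2) (by simpa [P] using div_pos (div_pos_of_neg_of_neg hneg hc0) two_pos)
    rw [hφ, map_zero] at h1
    have h2 : u / c / 2 * c = u / 2 := by
      rw [div_right_comm, div_mul_cancel₀ _ hc0.ne]
    linarith
  have hl : ∀ y, l y ≤ -c * (ε * ‖y‖) := fun y => by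
    by_contra! hlt
    have h1 := hφP (y, l y / -c) (by
      simp only [P, Set.mem_ofPred_eq]
      rw [lt_div_iff₀ (by linarith)]
      linarith)
    rw [hφ] at h1
    have h2 : l y / -c * c = -l y := by
      rw [div_neg, neg_mul, div_mul_cancel₀ _ hc0.ne]
    linarith
  have hlB : ∀ y ∈ B, -c * g (y - w) ≤ l (y - w) := fun y hy => by
    have h1 := hφQ (y - w, g (y - w)) ⟨by simpa using hy, le_rfl⟩
    rw [hφ] at h1
    linarith
  have hlabs : ∀ y, |l y| ≤ -c * (ε * ‖y‖) := fun y => by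
    refine abs_le.2 ⟨?_, hl y⟩
    have := hl (-y)
    rw [map_neg, norm_neg] at this
    linarith
  refine ⟨g - (-c)⁻¹ • l, ?_, w, hwB, fun y hy => ?_⟩
  · rw [sub_sub_cancel]
    refine ContinuousLinearMap.opNorm_le_bound _ hε.le fun y => ?_
    rw [smul_apply, smul_eq_mul, norm_mul, Real.norm_eq_abs, Real.norm_eq_abs,
      abs_of_pos (by simpa using hc0 : 0 < (-c)⁻¹), inv_mul_le_iff₀ (by linarith)]
    exact hlabs y
  · have h1 := hlB y hy
    have h2 : g (y - w) ≤ (-c)⁻¹ * l (y - w) := by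
      rw [← div_eq_inv_mul, le_div_iff₀ (by linarith)]
      linarith
    simp only [map_sub] at h2
    simp only [sub_apply, smul_apply, smul_eq_mul]
    linarith

/-- The complement of the range of an isometric map from a complete space is open. -/
theorem exists_forall_norm_sub_lt_notMem_range {Y Z : Type*} [NormedAddCommGroup Y]
    [CompleteSpace Y] [NormedAddCommGroup Z] {J : Y → Z} (hJ : ∀ x y, ‖J x - J y‖ = ‖x - y‖)
    {z : Z} (hz : z ∉ Set.range J) : ∃ ε > 0, ∀ y, ‖z - y‖ < ε → y ∉ Set.range J := by
  have hiso : Isometry J := Isometry.of_dist_eq fun x y => by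
    simpa only [dist_eq_norm] using hJ x y
  obtain ⟨ε, hε, hball⟩ :=
    Metric.isOpen_iff.1 hiso.isClosedEmbedding.isClosed_range.isOpen_compl z hz
  refine ⟨ε, hε, fun y hy => hball ?_⟩
  rwa [mem_ball, dist_comm, dist_eq_norm]

section

variable {X : Type*} [NormedAddCommGroup X] [NormedSpace ℝ X]

/-- **Helly's theorem**: finitely many values of an element of the bidual are approximated by
those of a point of `X` of no larger norm. -/
theorem exists_norm_le_forall_abs_sub_lt (h : StrongDual ℝ (StrongDual ℝ X))
    (G : Finset (StrongDual ℝ X)) {η : ℝ} (hη : 0 < η) :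
    ∃ x : X, ‖x‖ ≤ ‖h‖ ∧ ∀ g ∈ G, |g x - h g| < η := by
  classical
  let T : X →L[ℝ] (G → ℝ) := ContinuousLinearMap.pi fun g => g.1
  let v : G → ℝ := fun g => h g.1
  have hv : v ∈ closure (T '' closedBall 0 ‖h‖) := by
    by_contra hv
    obtain ⟨φ, u, hφ, hu⟩ := geometric_hahn_banach_closed_point
      (((convex_closedBall (0 : X) ‖h‖).is_linear_image T.isLinear).closure) isClosed_closure hv
    have hsum : ∀ y, φ y = ∑ i, y i * φ (fun j => if i = j then 1 else 0) := fun y =>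
      LinearMap.pi_apply_eq_sum_univ φ.toLinearMap y
    let g₀ : StrongDual ℝ X := ∑ i : G, φ (fun j => if i = j then 1 else 0) • i.1
    have hg₀ : ∀ x, φ (T x) = g₀ x := fun x => by
      rw [hsum]
      simp [g₀, T, mul_comm]
    have hhg₀ : φ v = h g₀ := by
      rw [hsum]
      simp [g₀, v, mul_comm]
    have hlt : ∀ x, ‖x‖ ≤ ‖h‖ → g₀ x < u := fun x hx => by
      rw [← hg₀]
      exact hφ _ (subset_closure ⟨x, by simpa using hx, rfl⟩)
    have hu0 : 0 < u := by simpa using hlt 0 (by rw [norm_zero]; exact norm_nonneg h)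
    have h1 : h g₀ ≤ ‖h‖ * ‖g₀‖ := (le_abs_self _).trans (h.le_opNorm g₀)
    rcases (norm_nonneg h).eq_or_lt with h0 | hpos
    · rw [← h0, zero_mul] at h1
      linarith
    · have hnorm : ‖g₀‖ ≤ u / ‖h‖ := by
        refine g₀.opNorm_le_of_unit_norm (by positivity) fun x hx => ?_
        have habs : |g₀ x| * ‖h‖ = |g₀ x * ‖h‖| := by rw [abs_mul, abs_of_pos hpos]
        rw [le_div_iff₀ hpos, Real.norm_eq_abs, habs]
        have hle : ‖‖h‖ • x‖ ≤ ‖h‖ := by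
          rw [norm_smul, hx, mul_one, Real.norm_of_nonneg hpos.le]
        have h1 := hlt (‖h‖ • x) hle
        have h2 := hlt (-(‖h‖ • x)) (by rwa [norm_neg])
        simp only [map_neg, map_smul, smul_eq_mul] at h1 h2
        exact abs_le.2 ⟨by linarith, by linarith⟩
      rw [le_div_iff₀ hpos] at hnorm
      linarith
  obtain ⟨_, ⟨x, hx, rfl⟩, hdist⟩ := Metric.mem_closure_iff.1 hv η hη
  refine ⟨x, by simpa using hx, fun g hg => ?_⟩
  have := (dist_pi_lt_iff hη).1 hdist ⟨g, hg⟩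
  rwa [dist_comm, Real.dist_eq] at this

/-- A closed set whose distance is not attained near the origin, built from pieces of hyperplanes
around a uniformly separated maximizing sequence for a functional. -/
theorem exists_no_nearest_point_of_separated_maximizing_seq (f : StrongDual ℝ X) (hf : ‖f‖ ≤ 1)
    {ρ : ℝ} (hρ : 0 < ρ) {x : ℕ → X} (hfx : Tendsto (fun n => f (x n)) atTop (𝓝 ρ))
    (hx : Tendsto (fun n => ‖x n‖) atTop (𝓝 ρ)) {δ : ℝ} (hδ : 0 < δ)
    (hsep : ∀ m n, m < n → δ ≤ ‖x m - x n‖) :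
    ∃ (C U : Set X), C.Nonempty ∧ IsClosed C ∧ U.Nonempty ∧ IsOpen U ∧ U ⊆ Cᶜ ∧
      ∀ x ∈ U, ¬ ∃ z ∈ C, ‖x - z‖ = Metric.infDist x C := by
  have hf_le : ∀ y, f y ≤ ‖y‖ := fun y =>
    (le_abs_self _).trans (f.le_of_opNorm_le hf y |>.trans_eq (one_mul _))
  have hf_abs : ∀ y, |f y| ≤ ‖y‖ := fun y => f.le_of_opNorm_le hf y |>.trans_eq (one_mul _)
  obtain ⟨v, hv⟩ : ∃ v, f v = 1 := by
    obtain ⟨n, hn⟩ := (hfx.eventually (lt_mem_nhds hρ)).exists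
    exact ⟨(f (x n))⁻¹ • x n, by simp [hn.ne']⟩
  let D : ℕ → Set X := fun n => {c | f c = ρ + 1 / ((n : ℝ) + 1)} ∩ closedBall (x n) (δ / 4)
  let C : Set X := ⋃ n, D n
  have hCf : ∀ c ∈ C, ρ < f c := by
    intro c hc
    obtain ⟨n, hn, -⟩ := Set.mem_iUnion.1 hc
    rw [hn]
    have : 0 < 1 / ((n : ℝ) + 1) := Nat.one_div_pos_of_nat
    linarith
  have hCclosed : IsClosed C := by
    refine LocallyFinite.isClosed_iUnion (fun y => ?_)
      fun n => (isClosed_eq f.continuous continuous_const).inter isClosed_closedBall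
    refine ⟨ball y (δ / 8), ball_mem_nhds y (by positivity), Set.Subsingleton.finite ?_⟩
    have key : ∀ m n, m < n → (D m ∩ ball y (δ / 8)).Nonempty →
        (D n ∩ ball y (δ / 8)).Nonempty → False := by
      rintro m n hmn ⟨a, ⟨-, ha⟩, hay⟩ ⟨b, ⟨-, hb⟩, hby⟩
      have h1 := hsep m n hmn
      rw [← dist_eq_norm] at h1
      rw [mem_closedBall] at ha hb
      rw [mem_ball] at hay hby
      have h2 := dist_triangle (x m) a (x n)
      have h3 := dist_triangle a y (x n)
      have h4 := dist_triangle y b (x n)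
      rw [dist_comm (x m) a] at h2
      rw [dist_comm y b] at h4
      linarith
    intro m hm n hn
    rcases lt_trichotomy m n with hlt | heq | hgt
    · exact (key m n hlt hm hn).elim
    · exact heq
    · exact (key n m hgt hn hm).elim
  let r := min (δ / 8) ρ
  have hr : 0 < r := by positivity
  have hUf : ∀ u ∈ ball (0 : X) r, f u < ρ := fun u hu =>
    (hf_le u).trans_lt ((mem_ball_zero_iff.1 hu).trans_le (min_le_right _ _))
  have hclose : ∀ u ∈ ball (0 : X) r, ∀ η > 0, ∃ c ∈ C, ‖u - c‖ < ρ - f u + η := by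
    intro u hu η hη
    have hfu := hUf u hu
    have hu' : ‖u‖ < δ / 8 := (mem_ball_zero_iff.1 hu).trans_le (min_le_left _ _)
    have hfu' : |f u| < δ / 8 := (hf_abs u).trans_lt hu'
    set s := 1 - f u / ρ with hs
    have hs0 : 0 < s := by
      rw [hs, sub_pos, div_lt_one hρ]
      exact hfu
    have hsρ : s * ρ = ρ - f u := by
      rw [hs]
      field_simp
    let w : ℕ → ℝ := fun n => ρ + 1 / ((n : ℝ) + 1) - f u - s * f (x n)
    have hw : Tendsto w atTop (𝓝 0) := by
      have h1 := ((tendsto_one_div_add_atTop_nhds_zero_nat (𝕜 := ℝ)).const_add ρ).sub_const (f u)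
      have h2 := h1.sub (hfx.const_mul s)
      rwa [hsρ, add_zero, sub_self] at h2
    have hwv : Tendsto (fun n => |w n| * ‖v‖) atTop (𝓝 0) := by
      simpa using hw.abs.mul_const ‖v‖
    have hlim₁ : Tendsto (fun n => s * ‖x n‖ + |w n| * ‖v‖) atTop (𝓝 (ρ - f u)) := by
      have := (hx.const_mul s).add hwv
      rwa [hsρ, add_zero] at this
    have hlim₂ : Tendsto (fun n => ‖u‖ + |f u| / ρ * ‖x n‖ + |w n| * ‖v‖) atTop
        (𝓝 (‖u‖ + |f u|)) := by
      have := ((hx.const_mul (|f u| / ρ)).const_add ‖u‖).add hwv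
      rwa [div_mul_cancel₀ _ hρ.ne', add_zero] at this
    obtain ⟨n, hn₁, hn₂⟩ := ((hlim₁.eventually (gt_mem_nhds (by linarith :
      ρ - f u < ρ - f u + η))).and (hlim₂.eventually (gt_mem_nhds (by linarith :
      ‖u‖ + |f u| < δ / 4)))).exists
    refine ⟨u + s • x n + w n • v, Set.mem_iUnion.2 ⟨n, ?_, ?_⟩, ?_⟩
    · simp only [Set.mem_ofPred_eq, map_add, map_smul, smul_eq_mul, hv, w]
      ring
    · rw [mem_closedBall, dist_eq_norm]
      have heq : u + s • x n + w n • v - x n = u - (f u / ρ) • x n + w n • v := by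
        rw [hs]
        module
      rw [heq]
      refine ((norm_add_le _ _).trans <| add_le_add (norm_sub_le _ _) le_rfl).trans ?_
      rw [norm_smul, norm_smul, norm_div, Real.norm_eq_abs, Real.norm_eq_abs, Real.norm_eq_abs,
        abs_of_pos hρ]
      exact hn₂.le
    · have heq : u - (u + s • x n + w n • v) = -(s • x n + w n • v) := by module
      rw [heq, norm_neg]
      refine (norm_add_le _ _).trans_lt ?_
      rw [norm_smul, norm_smul, Real.norm_of_nonneg hs0.le, Real.norm_eq_abs]
      exact hn₁
  refine ⟨C, ball 0 r, ?_, hCclosed, ⟨0, mem_ball_self hr⟩, isOpen_ball, ?_, ?_⟩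
  · obtain ⟨c, hc, -⟩ := hclose 0 (mem_ball_self hr) 1 one_pos
    exact ⟨c, hc⟩
  · exact fun u hu hc => (hUf u hu).not_gt (hCf u hc)
  · rintro u hu ⟨z, hz, hzd⟩
    have h1 : f z - f u ≤ ‖u - z‖ := by
      rw [← map_sub, norm_sub_rev]
      exact hf_le _
    have h2 := hCf z hz
    obtain ⟨c, hc, hcd⟩ := hclose u hu (f z - ρ) (by linarith)
    have h3 := infDist_le_dist_of_mem (x := u) hc
    rw [dist_eq_norm] at h3
    linarith

/-- If an element `h` of the bidual attains its norm and is a weak-star limit of points of `X`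
with norms at most about `‖h‖` that stay away from `h`, then nearest points fail to exist
on an open set. -/
theorem exists_no_nearest_point_of_approx (h : StrongDual ℝ (StrongDual ℝ X)) (hpos : 0 < ‖h‖)
    (f : StrongDual ℝ X) (hf : ‖f‖ ≤ 1) (hhf : h f = ‖h‖) {δ : ℝ} (hδ : 0 < δ)
    (happ : ∀ (G : Finset (StrongDual ℝ X)) (η : ℝ), 0 < η →
      ∃ x : X, δ ≤ ‖h - inclusionInDoubleDual ℝ X x‖ ∧ ‖x‖ ≤ ‖h‖ + η ∧ ∀ g ∈ G, |g x - h g| < η) :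
    ∃ (C U : Set X), C.Nonempty ∧ IsClosed C ∧ U.Nonempty ∧ IsOpen U ∧ U ⊆ Cᶜ ∧
      ∀ x ∈ U, ¬ ∃ z ∈ C, ‖x - z‖ = Metric.infDist x C := by
  classical
  have hwit : ∀ y : X, ∃ g : StrongDual ℝ X, δ ≤ ‖h - inclusionInDoubleDual ℝ X y‖ →
      ‖g‖ ≤ 1 ∧ δ / 2 < h g - g y := by
    intro y
    by_cases hy : δ ≤ ‖h - inclusionInDoubleDual ℝ X y‖
    · obtain ⟨g, hg, hlt⟩ := ContinuousLinearMap.exists_lt_apply_of_lt_opNorm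
        (h - inclusionInDoubleDual ℝ X y) (by linarith : δ / 2 < _)
      rw [Real.norm_eq_abs, lt_abs] at hlt
      rcases hlt with hlt | hlt
      · exact ⟨g, fun _ => ⟨hg.le, by simpa using hlt⟩⟩
      · exact ⟨-g, fun _ => ⟨by simpa using hg.le, by simpa [add_comm, sub_eq_add_neg] using hlt⟩⟩
    · exact ⟨0, fun hy' => (hy hy').elim⟩
  choose g hg using hwit
  obtain ⟨F, hFP, hFr⟩ := exists_seq_of_forall_finset_exists
    (fun p : X × ℕ => δ ≤ ‖h - inclusionInDoubleDual ℝ X p.1‖ ∧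
      ‖p.1‖ ≤ ‖h‖ + 1 / ((p.2 : ℝ) + 1) ∧ |f p.1 - ‖h‖| ≤ 1 / ((p.2 : ℝ) + 1))
    (fun p q => p.2 < q.2 ∧ δ / 4 ≤ ‖p.1 - q.1‖) (by
      intro s hs
      let N : ℕ := s.sup Prod.snd + 1
      have hη : 0 < min (1 / ((N : ℝ) + 1)) (δ / 4) :=
        lt_min Nat.one_div_pos_of_nat (by positivity)
      obtain ⟨x, hx₁, hx₂, hx₃⟩ := happ (insert f (s.image fun p => g p.1)) _ hη
      refine ⟨(x, N), ⟨hx₁, hx₂.trans (by gcongr; exact min_le_left _ _), ?_⟩, fun p hp =>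
        ⟨Nat.lt_succ_of_le (Finset.le_sup (f := Prod.snd) hp), ?_⟩⟩
      · rw [← hhf]
        exact (hx₃ f (Finset.mem_insert_self _ _)).le.trans (min_le_left _ _)
      · obtain ⟨hn, hgt⟩ := hg p.1 (hs p hp).1
        have h1 := (hx₃ (g p.1) (Finset.mem_insert_of_mem
          (Finset.mem_image_of_mem (fun p => g p.1) hp))).trans_le (min_le_right _ _)
        have h2 : |g p.1 (p.1 - x)| ≤ ‖p.1 - x‖ :=
          ((g p.1).le_of_opNorm_le hn _).trans_eq (one_mul _)
        rw [map_sub] at h2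
        have h3 := neg_abs_le (g p.1 p.1 - g p.1 x)
        have h4 := (abs_lt.1 h1).1
        simp only
        linarith)
  have hmono : StrictMono fun n => (F n).2 := strictMono_nat_of_lt_succ fun n =>
    (hFr n (n + 1) n.lt_succ_self).1
  have hlim : Tendsto (fun n => 1 / (((F n).2 : ℝ) + 1)) atTop (𝓝 0) :=
    (tendsto_one_div_add_atTop_nhds_zero_nat (𝕜 := ℝ)).comp hmono.tendsto_atTop
  refine exists_no_nearest_point_of_separated_maximizing_seq f hf hpos (x := fun n => (F n).1)
    ?_ ?_ (by positivity : 0 < δ / 4) fun m n hmn => (hFr m n hmn).2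
  · refine tendsto_iff_dist_tendsto_zero.2 (squeeze_zero (fun _ => dist_nonneg) (fun n => ?_) hlim)
    exact (hFP n).2.2
  · refine tendsto_of_tendsto_of_tendsto_of_le_of_le (g := fun n => ‖h‖ - 1 / (((F n).2 : ℝ) + 1))
      (h := fun n => ‖h‖ + 1 / (((F n).2 : ℝ) + 1)) (by simpa using hlim.const_sub ‖h‖)
      (by simpa using hlim.const_add ‖h‖) (fun n => ?_) fun n => (hFP n).2.1
    have h1 := (abs_le.1 (hFP n).2.2).1
    have h2 : f (F n).1 ≤ ‖(F n).1‖ :=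
      (le_abs_self _).trans ((f.le_of_opNorm_le hf _).trans_eq (one_mul _))
    simp only
    linarith

theorem exists_no_nearest_point_of_not_isReflexiveSpace [CompleteSpace X]
    (hX : ¬ IsReflexiveSpace X) :
    ∃ (C U : Set X), C.Nonempty ∧ IsClosed C ∧ U.Nonempty ∧ IsOpen U ∧ U ⊆ Cᶜ ∧
      ∀ x ∈ U, ¬ ∃ z ∈ C, ‖x - z‖ = Metric.infDist x C := by
  have hopen : ∀ h ∉ Set.range (inclusionInDoubleDual ℝ X), ∃ ε > 0, ∀ k,
      ‖h - k‖ < ε → k ∉ Set.range (inclusionInDoubleDual ℝ X) := by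
    intro h hh
    refine exists_forall_norm_sub_lt_notMem_range (fun x y => ?_) hh
    rw [← (inclusionInDoubleDual ℝ X).map_sub]
    exact (inclusionInDoubleDualLi (E := X) ℝ).norm_map _
  obtain ⟨h₀, hh₀⟩ : ∃ h₀, h₀ ∉ Set.range (inclusionInDoubleDual ℝ X) := by
    simpa [IsReflexiveSpace, Function.Surjective] using hX
  obtain ⟨ε, hε, hball⟩ := hopen h₀ hh₀
  have hbdd : BddAbove (h₀ '' closedBall 0 1) := by
    refine ⟨‖h₀‖, ?_⟩
    rintro _ ⟨y, hy, rfl⟩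
    exact (le_abs_self _).trans (h₀.unit_le_opNorm y (by simpa using hy))
  obtain ⟨h, hh, f, hf, hmax⟩ := exists_norm_sub_le_and_isMaxOn h₀ isClosed_closedBall
    (convex_closedBall 0 1) hbdd ⟨0, by simp⟩ (half_pos hε)
  rw [mem_closedBall_zero_iff] at hf
  have hmem : h ∉ Set.range (inclusionInDoubleDual ℝ X) := hball h (by linarith)
  have hpos : 0 < ‖h‖ := norm_pos_iff.2 fun h0 => hmem ⟨0, by simp [h0]⟩
  have hhf : h f = ‖h‖ := by
    refine le_antisymm ((le_abs_self _).trans (h.unit_le_opNorm f hf)) ?_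
    have h0 : 0 ≤ h f := by simpa using hmax 0 (by simp)
    refine h.opNorm_le_of_unit_norm h0 fun y hy => abs_le.2 ⟨?_, hmax y (by simp [hy])⟩
    have := hmax (-y) (by simp [hy])
    rw [map_neg] at this
    linarith
  obtain ⟨δ, hδ, hball'⟩ := hopen h hmem
  refine exists_no_nearest_point_of_approx h hpos f hf hhf hδ fun G η hη => ?_
  obtain ⟨x, hx, hxG⟩ := exists_norm_le_forall_abs_sub_lt h G hη
  refine ⟨x, ?_, by linarith, hxG⟩
  by_contra! hlt
  exact hball' _ hlt ⟨x, rfl⟩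

theorem exists_no_nearest_point_of_not_isKadecSpace (hX : ¬ IsKadecSpace X) :
    ∃ (C U : Set X), C.Nonempty ∧ IsClosed C ∧ U.Nonempty ∧ IsOpen U ∧ U ⊆ Cᶜ ∧
      ∀ x ∈ U, ¬ ∃ z ∈ C, ‖x - z‖ = Metric.infDist x C := by
  simp only [IsKadecSpace, not_forall] at hX
  obtain ⟨u, x, hweak, hnorm, hnot⟩ := hX
  have hx : x ≠ 0 := by
    rintro rfl
    exact hnot (tendsto_zero_iff_norm_tendsto_zero.2 (by simpa using hnorm))
  have hJ : ∀ y : X, ‖inclusionInDoubleDual ℝ X y‖ = ‖y‖ :=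
    (inclusionInDoubleDualLi (E := X) ℝ).norm_map
  obtain ⟨δ, hδ, hfreq⟩ : ∃ δ > 0, ∃ᶠ n in atTop, δ ≤ ‖x - u n‖ := by
    by_contra! hcon
    refine hnot (Metric.tendsto_nhds.2 fun ε hε => ?_)
    have := hcon ε hε
    filter_upwards [this] with n hn
    rwa [dist_comm, dist_eq_norm]
  obtain ⟨f, hf, hfx⟩ := exists_dual_vector ℝ x (norm_ne_zero_iff.2 hx)
  refine exists_no_nearest_point_of_approx (inclusionInDoubleDual ℝ X x)
    (by rw [hJ]; exact norm_pos_iff.2 hx) f hf.le (by rw [hJ, dual_def]; simpa using hfx) hδ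
    fun G η hη => ?_
  have hG : ∀ᶠ n in atTop, ∀ g ∈ G, |g (u n) - g x| < η :=
    (Filter.eventually_all_finset G).2 fun g _ => by
      simpa [Real.dist_eq] using Metric.tendsto_nhds.1 (hweak g) η hη
  obtain ⟨n, hn₁, hn₂, hn₃⟩ := (hfreq.and_eventually
    (hG.and (hnorm.eventually (gt_mem_nhds (by linarith : ‖x‖ < ‖x‖ + η))))).exists
  refine ⟨u n, ?_, ?_, fun g hg => ?_⟩
  · rwa [← (inclusionInDoubleDual ℝ X).map_sub, hJ]
  · rw [hJ]
    exact hn₃.le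
  · rw [dual_def]
    exact hn₂ g hg

end

/-- If a real Banach space `X` is not both reflexive and Kadec, then there exist a nonempty
closed set `C ⊆ X` and a nonempty open set `U ⊆ X \ C` such that no point of `U` has a
nearest point in `C`. -/
theorem exists_no_nearest_point_of_not_reflexive_kadec
    (X : Type*) [NormedAddCommGroup X] [NormedSpace ℝ X] [CompleteSpace X]
    (h : ¬ (IsReflexiveSpace X ∧ IsKadecSpace X)) :
    ∃ (C U : Set X), C.Nonempty ∧ IsClosed C ∧ U.Nonempty ∧ IsOpen U ∧ U ⊆ Cᶜ ∧
      ∀ x ∈ U, ¬ ∃ z ∈ C, ‖x - z‖ = Metric.infDist x C := by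
  by_cases hr : IsReflexiveSpace X
  · exact exists_no_nearest_point_of_not_isKadecSpace fun hk => h ⟨hr, hk⟩
  · exact exists_no_nearest_point_of_not_isReflexiveSpace hr
end

section
/- If X is a reflexive real Banach space and f : X → ℝ is lower semicontinuous, then the set of points x ∈ X at which f is Fréchet sub-differentiable (i.e., ∂f(x) ≠ ∅) is dense in X. -/
open Metric Filter Topology

/-- The Fréchet subdifferential of `f : X → ℝ` at `x`: the set of continuous linear
functionals `φ` with `liminf_{y → 0} (f(x+y) - f(x) - φ(y))/‖y‖ ≥ 0`, expressed in
`ε`-`δ` form. -/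
def FrechetSubdiff {X : Type*} [NormedAddCommGroup X] [NormedSpace ℝ X]
    (f : X → ℝ) (x : X) : Set (X →L[ℝ] ℝ) :=
  {φ | ∀ ε > (0 : ℝ), ∃ δ > (0 : ℝ), ∀ y : X, ‖y‖ < δ →
    f (x + y) - f x - φ y ≥ -ε * ‖y‖}

open Set

section QuadraticMinorants

variable {E : Type*} [NormedAddCommGroup E] [NormedSpace ℝ E]

/-- Convex functions lying between `0` and the squared norm. -/
structure IsQuadraticMinorant (ψ : E → ℝ) : Prop where
  convex : ConvexOn ℝ univ ψ
  nonneg : ∀ z, 0 ≤ ψ z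
  le_sq : ∀ z, ψ z ≤ ‖z‖ ^ 2

/-- The failure of `ψ` to be affine at the midpoint of `z` and `w`. -/
noncomputable def midDefect (ψ : E → ℝ) (z w : E) : ℝ :=
  (ψ z + ψ w) / 2 - ψ ((1 / 2 : ℝ) • z + (1 / 2 : ℝ) • w)

/-- The midpoint defect of `ψ` dominates a multiple of the squared increment of the distance to
the segment `[0, q]`. -/
def ControlsSegment (ψ : E → ℝ) (q : E) : Prop :=
  ∃ κ > 0, ∀ z w, κ * (infDist z (segment ℝ 0 q) - infDist w (segment ℝ 0 q)) ^ 2 ≤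
    midDefect ψ z w

theorem ConvexOn.midDefect_nonneg {ψ : E → ℝ} (hψ : ConvexOn ℝ univ ψ) (z w : E) :
    0 ≤ midDefect ψ z w := by
  have := hψ.2 (mem_univ z) (mem_univ w) (by norm_num : (0 : ℝ) ≤ 1 / 2)
    (by norm_num : (0 : ℝ) ≤ 1 / 2) (by norm_num)
  simp only [smul_eq_mul] at this
  unfold midDefect
  linarith

theorem sq_sub_le_midDefect_sq {g : E → ℝ} (hg : ConvexOn ℝ univ g) (h0 : ∀ z, 0 ≤ g z)
    (z w : E) : (1 / 4) * (g z - g w) ^ 2 ≤ midDefect (fun x => g x ^ 2) z w := by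
  have := hg.2 (mem_univ z) (mem_univ w) (by norm_num : (0 : ℝ) ≤ 1 / 2)
    (by norm_num : (0 : ℝ) ≤ 1 / 2) (by norm_num)
  simp only [smul_eq_mul] at this
  unfold midDefect
  have h1 := h0 ((1 / 2 : ℝ) • z + (1 / 2 : ℝ) • w)
  have h2 := pow_le_pow_left₀ h1 this 2
  simp only
  nlinarith

theorem convexOn_infDist {K : Set E} (hK : Convex ℝ K) (hne : K.Nonempty) :
    ConvexOn ℝ univ fun z => infDist z K := by
  refine ⟨convex_univ, fun z _ w _ a b ha hb hab => ?_⟩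
  simp only [smul_eq_mul]
  refine le_of_forall_pos_le_add fun ε hε => ?_
  obtain ⟨p, hp, hzp⟩ := (infDist_lt_iff hne).1 (lt_add_of_pos_right (infDist z K) hε)
  obtain ⟨q, hq, hwq⟩ := (infDist_lt_iff hne).1 (lt_add_of_pos_right (infDist w K) hε)
  have h1 := infDist_le_dist_of_mem (x := a • z + b • w) (hK hp hq ha hb hab)
  have h2 : dist (a • z + b • w) (a • p + b • q) ≤ a * dist z p + b * dist w q := by
    rw [dist_eq_norm, dist_eq_norm, dist_eq_norm]
    have : a • z + b • w - (a • p + b • q) = a • (z - p) + b • (w - q) := by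
      simp only [smul_sub]; abel
    rw [this]
    refine (norm_add_le _ _).trans (le_of_eq ?_)
    rw [norm_smul, norm_smul, Real.norm_of_nonneg ha, Real.norm_of_nonneg hb]
  nlinarith

theorem infDist_segment_le_norm (q z : E) : infDist z (segment ℝ 0 q) ≤ ‖z‖ := by
  simpa using infDist_le_dist_of_mem (x := z) (left_mem_segment ℝ (0 : E) q)

theorem ConvexOn.sq_of_nonneg {g : E → ℝ} (hg : ConvexOn ℝ univ g) (h0 : ∀ z, 0 ≤ g z) :
    ConvexOn ℝ univ fun z => g z ^ 2 :=
  hg.pow (fun z _ => h0 z) 2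

theorem isQuadraticMinorant_infDist_sq (q : E) :
    IsQuadraticMinorant fun z : E => infDist z (segment ℝ 0 q) ^ 2 where
  convex := (convexOn_infDist (convex_segment 0 q) ⟨0, left_mem_segment ℝ 0 q⟩).sq_of_nonneg
    fun _ => infDist_nonneg
  nonneg _ := sq_nonneg _
  le_sq z := pow_le_pow_left₀ infDist_nonneg (infDist_segment_le_norm q z) 2

theorem controlsSegment_infDist_sq (q : E) :
    ControlsSegment (fun z : E => infDist z (segment ℝ 0 q) ^ 2) q :=
  ⟨1 / 4, by norm_num, sq_sub_le_midDefect_sq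
    (convexOn_infDist (convex_segment 0 q) ⟨0, left_mem_segment ℝ 0 q⟩) fun _ => infDist_nonneg⟩

theorem IsQuadraticMinorant.summable {ψ : ℕ → E → ℝ} (hψ : ∀ j, IsQuadraticMinorant (ψ j))
    {c : ℕ → ℝ} (hc : ∀ j, 0 ≤ c j) (hs : Summable c) (z : E) :
    Summable fun j => c j * ψ j z :=
  Summable.of_nonneg_of_le (fun j => mul_nonneg (hc j) ((hψ j).nonneg z))
    (fun j => mul_le_mul_of_nonneg_left ((hψ j).le_sq z) (hc j)) (hs.mul_right (‖z‖ ^ 2))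

theorem IsQuadraticMinorant.tsum {ψ : ℕ → E → ℝ} (hψ : ∀ j, IsQuadraticMinorant (ψ j))
    {c : ℕ → ℝ} (hc : ∀ j, 0 ≤ c j) (hs : Summable c) (h1 : ∑' j, c j ≤ 1) :
    IsQuadraticMinorant fun z => ∑' j, c j * ψ j z where
  convex := by
    refine ⟨convex_univ, fun z _ w _ a b ha hb hab => ?_⟩
    have hS := IsQuadraticMinorant.summable hψ hc hs
    simp only [smul_eq_mul]
    rw [← tsum_mul_left, ← tsum_mul_left, ← ((hS z).mul_left a).tsum_add ((hS w).mul_left b)]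
    refine (hS _).tsum_le_tsum (fun j => ?_) (((hS z).mul_left a).add ((hS w).mul_left b))
    have := (hψ j).convex.2 (mem_univ z) (mem_univ w) ha hb hab
    simp only [smul_eq_mul] at this
    nlinarith [hc j]
  nonneg z := tsum_nonneg fun j => mul_nonneg (hc j) ((hψ j).nonneg z)
  le_sq z := by
    calc ∑' j, c j * ψ j z ≤ ∑' j, c j * ‖z‖ ^ 2 :=
          (IsQuadraticMinorant.summable hψ hc hs z).tsum_le_tsum
            (fun j => mul_le_mul_of_nonneg_left ((hψ j).le_sq z) (hc j)) (hs.mul_right _)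
      _ = (∑' j, c j) * ‖z‖ ^ 2 := tsum_mul_right
      _ ≤ ‖z‖ ^ 2 := mul_le_of_le_one_left (sq_nonneg _) h1

theorem ControlsSegment.tsum {ψ : ℕ → E → ℝ} (hψ : ∀ j, IsQuadraticMinorant (ψ j))
    {c : ℕ → ℝ} (hc : ∀ j, 0 ≤ c j) (hs : Summable c) {j : ℕ} (hj : 0 < c j) {q : E}
    (hq : ControlsSegment (ψ j) q) : ControlsSegment (fun z => ∑' j, c j * ψ j z) q := by
  obtain ⟨κ, hκ, h⟩ := hq
  refine ⟨c j * κ, mul_pos hj hκ, fun z w => ?_⟩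
  have hS := IsQuadraticMinorant.summable hψ hc hs
  have hsum := (((hS z).add (hS w)).div_const 2).sub (hS ((1 / 2 : ℝ) • z + (1 / 2 : ℝ) • w))
  have key : midDefect (fun z => ∑' j, c j * ψ j z) z w = ∑' j, c j * midDefect (ψ j) z w := by
    unfold midDefect
    rw [← (hS z).tsum_add (hS w), ← tsum_div_const,
      ← (((hS z).add (hS w)).div_const 2).tsum_sub (hS _)]
    exact tsum_congr fun i => by ring
  have hsum' : Summable fun j => c j * midDefect (ψ j) z w :=
    hsum.congr fun i => by unfold midDefect; ring
  rw [key, mul_assoc]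
  exact (mul_le_mul_of_nonneg_left (h z w) hj.le).trans (hsum'.le_tsum j fun i _ =>
    mul_nonneg (hc i) ((hψ i).convex.midDefect_nonneg z w))

theorem exists_isQuadraticMinorant_controlsSegment {F : Set E}
    (hF : TopologicalSpace.IsSeparable F) :
    ∃ ψ : E → ℝ, IsQuadraticMinorant ψ ∧ F ⊆ closure {q | ControlsSegment ψ q} := by
  obtain ⟨D, hD, hFD⟩ := hF
  have hDne : (insert 0 D).Nonempty := insert_nonempty 0 D
  obtain ⟨d, hd⟩ := (hD.insert 0).exists_eq_range hDne
  have hψ := fun j => isQuadraticMinorant_infDist_sq (d j)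
  have hc : ∀ j : ℕ, 0 < (1 / 2 : ℝ) / 2 ^ j := fun j => by positivity
  have hs : HasSum (fun j : ℕ => (1 / 2 : ℝ) / 2 ^ j) 1 :=
    hasSum_geometric_two' (1 : ℝ)
  refine ⟨fun z => ∑' j, (1 / 2 : ℝ) / 2 ^ j * infDist z (segment ℝ 0 (d j)) ^ 2,
    IsQuadraticMinorant.tsum hψ (fun j => (hc j).le) hs.summable hs.tsum_eq.le,
    hFD.trans (closure_mono fun q hq => ?_)⟩
  obtain ⟨j, rfl⟩ : q ∈ range d := hd ▸ mem_insert_of_mem 0 hq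
  exact ControlsSegment.tsum hψ (fun j => (hc j).le) hs.summable (hc j)
    (controlsSegment_infDist_sq (d j))

/-- Convex functions lying between the squared norm and its double. -/
structure IsQuadraticallyComparable (h : E → ℝ) : Prop where
  convex : ConvexOn ℝ univ h
  sq_le : ∀ z, ‖z‖ ^ 2 ≤ h z
  le_two_sq : ∀ z, h z ≤ 2 * ‖z‖ ^ 2

theorem IsQuadraticallyComparable.continuous {h : E → ℝ} (hh : IsQuadraticallyComparable h) :
    Continuous h := by
  rw [← continuousOn_univ]
  have hequiv := (hh.convex.continuousOn_tfae isOpen_univ univ_nonempty).out 3 1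
  refine hequiv.1 ⟨0, mem_univ _, 2, ?_⟩
  rw [eventually_map]
  filter_upwards [ball_mem_nhds (0 : E) one_pos] with z hz
  have : ‖z‖ < 1 := by simpa using hz
  nlinarith [hh.le_two_sq z, norm_nonneg z]

theorem IsQuadraticMinorant.sq_add {ψ : E → ℝ} (hψ : IsQuadraticMinorant ψ) :
    IsQuadraticallyComparable fun z => ‖z‖ ^ 2 + ψ z where
  convex := (convexOn_univ_norm.sq_of_nonneg norm_nonneg).add hψ.convex
  sq_le z := by linarith [hψ.nonneg z]
  le_two_sq z := by linarith [hψ.le_sq z]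

/-- If two points are almost affinely related by `‖·‖ ^ 2 + ψ` and one of them is a limit of
points whose segments are controlled by `ψ`, then they are close to each other. -/
theorem IsQuadraticMinorant.norm_sub_lt_of_midDefect {ψ : E → ℝ} (hψ : IsQuadraticMinorant ψ)
    {w : E} (hw : w ∈ closure {q | ControlsSegment ψ q}) {ε : ℝ} (hε : 0 < ε) :
    ∃ δ > 0, ∀ z, midDefect (fun z => ‖z‖ ^ 2 + ψ z) z w ≤ δ → ‖z - w‖ < ε := by
  obtain ⟨q, ⟨κ, hκ, hq⟩, hwq⟩ := Metric.mem_closure_iff.1 hw (ε / 8) (by positivity)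
  rw [dist_eq_norm] at hwq
  refine ⟨min (1 / 4) κ * (ε / 16) ^ 2, by positivity, fun z hz => ?_⟩
  have hsplit : midDefect (fun z => ‖z‖ ^ 2 + ψ z) z w =
      midDefect (fun z => ‖z‖ ^ 2) z w + midDefect ψ z w := by
    unfold midDefect; ring
  have hn := sq_sub_le_midDefect_sq (convexOn_univ_norm (E := E)) norm_nonneg z w
  have hd0 := hψ.convex.midDefect_nonneg z w
  have hn0 := (convexOn_univ_norm.sq_of_nonneg (norm_nonneg (E := E))).midDefect_nonneg z w
  have hqz := hq z w
  rw [hsplit] at hz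
  have hε2 : 0 < (ε / 16) ^ 2 := by positivity
  have h1 : |‖z‖ - ‖w‖| ≤ ε / 16 := by
    refine abs_le_of_sq_le_sq ?_ (by positivity)
    have := mul_le_mul_of_nonneg_right (min_le_left (1 / 4) κ) hε2.le
    linarith
  have h2 : |infDist z (segment ℝ 0 q) - infDist w (segment ℝ 0 q)| ≤ ε / 16 := by
    refine abs_le_of_sq_le_sq ?_ (by positivity)
    have := mul_le_mul_of_nonneg_right (min_le_right (1 / 4) κ) hε2.le
    exact le_of_mul_le_mul_left (by linarith) hκ
  have h3 : infDist w (segment ℝ 0 q) ≤ ‖w - q‖ := by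
    simpa [dist_eq_norm] using infDist_le_dist_of_mem (x := w) (right_mem_segment ℝ (0 : E) q)
  have h4 : infDist z (segment ℝ 0 q) < ε / 4 := by linarith [(abs_le.1 h2).2]
  obtain ⟨p, hp, hzp⟩ := (infDist_lt_iff ⟨0, left_mem_segment ℝ 0 q⟩).1 h4
  rw [segment_eq_image] at hp
  obtain ⟨t, ⟨ht0, ht1⟩, rfl⟩ := hp
  simp only [smul_zero, zero_add, dist_eq_norm] at hzp
  have h5 : ‖t • q - q‖ = ‖q‖ - ‖t • q‖ := by
    rw [show t • q - q = -((1 - t) • q) by rw [sub_smul, one_smul]; abel, norm_neg, norm_smul,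
      norm_smul, Real.norm_of_nonneg ht0, Real.norm_of_nonneg (by linarith)]
    ring
  have h6 : ‖z‖ ≤ ‖z - t • q‖ + ‖t • q‖ := by
    simpa using norm_add_le (z - t • q) (t • q)
  have h7 : ‖q‖ ≤ ‖w‖ + ‖w - q‖ := by
    simpa using norm_sub_le w (w - q)
  have h8 : ‖z - w‖ ≤ ‖z - t • q‖ + ‖t • q - q‖ + ‖w - q‖ := by
    have : z - w = (z - t • q) + (t • q - q) - (w - q) := by abel
    rw [this]
    exact (norm_sub_le _ _).trans (by gcongr; exact norm_add_le _ _)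
  linarith [(abs_le.1 h1).1]

end QuadraticMinorants

section Conjugate

variable {X : Type*} [NormedAddCommGroup X] [NormedSpace ℝ X]

/-- The Fenchel conjugate, on the predual, of a function on the dual. -/
noncomputable def preconjugate (h : (X →L[ℝ] ℝ) → ℝ) (u : X) : ℝ :=
  ⨆ z : X →L[ℝ] ℝ, (z u - h z)

namespace IsQuadraticallyComparable

variable {h h' : (X →L[ℝ] ℝ) → ℝ}

theorem apply_sub_le (hh : IsQuadraticallyComparable h) (u : X) (z : X →L[ℝ] ℝ) :
    z u - h z ≤ ‖z‖ * (‖u‖ - ‖z‖) := by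
  have h1 := (le_abs_self _).trans (z.le_opNorm u)
  nlinarith [hh.sq_le z]

theorem apply_sub_le_sq (hh : IsQuadraticallyComparable h) (u : X) (z : X →L[ℝ] ℝ) :
    z u - h z ≤ ‖u‖ ^ 2 / 4 := by
  nlinarith [hh.apply_sub_le u z, sq_nonneg (‖z‖ - ‖u‖ / 2)]

theorem le_preconjugate (hh : IsQuadraticallyComparable h) (u : X) (z : X →L[ℝ] ℝ) :
    z u - h z ≤ preconjugate h u :=
  le_ciSup (f := fun z : X →L[ℝ] ℝ => z u - h z)
    ⟨‖u‖ ^ 2 / 4, by rintro _ ⟨z, rfl⟩; exact hh.apply_sub_le_sq u z⟩ z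

theorem preconjugate_le_sq (hh : IsQuadraticallyComparable h) (u : X) :
    preconjugate h u ≤ ‖u‖ ^ 2 / 4 :=
  ciSup_le (hh.apply_sub_le_sq u)

theorem sq_le_preconjugate (hh : IsQuadraticallyComparable h) (u : X) :
    ‖u‖ ^ 2 / 8 ≤ preconjugate h u := by
  obtain ⟨g, hg, hgu⟩ := exists_dual_vector'' ℝ u
  refine le_trans ?_ (hh.le_preconjugate u ((‖u‖ / 4) • g))
  have h1 := hh.le_two_sq ((‖u‖ / 4) • g)
  have h2 : ‖(‖u‖ / 4) • g‖ ≤ ‖u‖ / 4 := by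
    rw [norm_smul, Real.norm_of_nonneg (by positivity)]
    exact mul_le_of_le_one_right (by positivity) hg
  have h3 := pow_le_pow_left₀ (norm_nonneg _) h2 2
  have h4 : ((‖u‖ / 4) • g) u = ‖u‖ ^ 2 / 4 := by
    simp only [smul_apply, smul_eq_mul, hgu, RCLike.ofReal_real_eq_id, id]
    ring
  rw [h4]
  nlinarith

theorem preconjugate_nonneg (hh : IsQuadraticallyComparable h) (u : X) :
    0 ≤ preconjugate h u :=
  le_trans (by positivity) (hh.sq_le_preconjugate u)

theorem preconjugate_zero (hh : IsQuadraticallyComparable h) : preconjugate h 0 = 0 :=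
  le_antisymm (by simpa using hh.preconjugate_le_sq 0) (hh.preconjugate_nonneg 0)

theorem preconjugate_anti (hh : IsQuadraticallyComparable h) (hle : ∀ z, h z ≤ h' z) (u : X) :
    preconjugate h' u ≤ preconjugate h u :=
  ciSup_le fun z => (sub_le_sub_left (hle z) _).trans (hh.le_preconjugate u z)

theorem preconjugate_le_add (hh : IsQuadraticallyComparable h)
    (hh' : IsQuadraticallyComparable h') {τ : ℝ} (hτ : 0 ≤ τ)
    (hle : ∀ z, h' z ≤ h z + τ * ‖z‖ ^ 2) (u : X) :
    preconjugate h u ≤ preconjugate h' u + τ * ‖u‖ ^ 2 := by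
  refine ciSup_le fun z => ?_
  rcases le_total ‖u‖ ‖z‖ with hz | hz
  · have h1 := hh.apply_sub_le u z
    have h2 := hh'.preconjugate_nonneg u
    have h3 : 0 ≤ τ * ‖u‖ ^ 2 := by positivity
    nlinarith [norm_nonneg z]
  · have h1 := hh'.le_preconjugate u z
    have h2 := mul_le_mul_of_nonneg_left (pow_le_pow_left₀ (norm_nonneg z) hz 2) hτ
    linarith [hle z]

theorem preconjugate_le_add_norm_sub (hh : IsQuadraticallyComparable h) (u v : X) :
    preconjugate h u ≤ preconjugate h v + ‖u - v‖ * ‖u‖ := by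
  refine ciSup_le fun z => ?_
  rcases le_total ‖u‖ ‖z‖ with hz | hz
  · have h1 := hh.apply_sub_le u z
    have h2 := hh.preconjugate_nonneg v
    have h3 : 0 ≤ ‖u - v‖ * ‖u‖ := by positivity
    nlinarith [norm_nonneg z]
  · have h1 := hh.le_preconjugate v z
    have h2 : z u - z v ≤ ‖z‖ * ‖u - v‖ := by
      rw [← map_sub]; exact (le_abs_self _).trans (z.le_opNorm _)
    nlinarith [norm_nonneg (u - v)]

theorem exists_lt_apply_sub (h : (X →L[ℝ] ℝ) → ℝ) (u : X) {δ : ℝ} (hδ : 0 < δ) :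
    ∃ z : X →L[ℝ] ℝ, preconjugate h u - δ < z u - h z :=
  exists_lt_of_lt_ciSup (sub_lt_self _ hδ)

theorem norm_le_of_preconjugate_sub_lt (hh : IsQuadraticallyComparable h) {u : X}
    {z : X →L[ℝ] ℝ} (hz : preconjugate h u - 1 < z u - h z) : ‖z‖ ≤ ‖u‖ + 1 := by
  have h1 := hh.apply_sub_le u z
  have h2 := hh.preconjugate_nonneg u
  by_contra! h3
  nlinarith [norm_nonneg u]

/-- If near-maximizers in the definition of the preconjugate at `u` converge to `w`, then the
preconjugate is Fréchet superdifferentiable at `u` with derivative `w`. -/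
theorem preconjugate_add_le (hh : IsQuadraticallyComparable h) {u : X} {w : X →L[ℝ] ℝ}
    (hw : ∀ ε > 0, ∃ δ > 0, ∀ z : X →L[ℝ] ℝ,
      preconjugate h u - δ ≤ z u - h z → ‖z - w‖ < ε) {ε : ℝ} (hε : 0 < ε) :
    ∃ δ > 0, ∀ y, ‖y‖ < δ →
      preconjugate h (u + y) ≤ preconjugate h u + w y + ε * ‖y‖ := by
  obtain ⟨δ, hδ, H⟩ := hw ε hε
  set K := ‖u‖ + 1 + ‖w‖ with hK
  have hK1 : 1 ≤ K := by linarith [norm_nonneg u, norm_nonneg w]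
  refine ⟨min (δ / K) (1 / (2 * K)), by positivity, fun y hy => ciSup_le fun z => ?_⟩
  have hy1 : ‖y‖ * K < δ := (lt_div_iff₀ (by positivity)).1 (hy.trans_le (min_le_left _ _))
  have hy2 : ‖y‖ * (2 * K) < 1 := (lt_div_iff₀ (by positivity)).1 (hy.trans_le (min_le_right _ _))
  have hwy : -(‖w‖ * ‖y‖) ≤ w y := neg_le_of_neg_le
    ((neg_le_abs _).trans (w.le_opNorm y))
  have hzy := (le_abs_self _).trans (z.le_opNorm y)
  have hεy : 0 ≤ ε * ‖y‖ := by positivity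
  have hy0 := norm_nonneg y
  rw [map_add]
  by_cases hz : preconjugate h u - δ ≤ z u - h z
  · have h1 := hh.le_preconjugate u z
    have h2 : z y - w y ≤ ε * ‖y‖ := by
      rw [← sub_apply]
      exact (le_abs_self _).trans (((z - w).le_opNorm y).trans
        (mul_le_mul_of_nonneg_right (H z hz).le (norm_nonneg y)))
    linarith
  · push Not at hz
    rcases le_total ‖z‖ (‖u‖ + 1) with h1 | h1
    · nlinarith
    · have h2 := hh.apply_sub_le u z
      have h3 := hh.preconjugate_nonneg u
      have h4 : ‖z‖ * (‖u‖ - ‖z‖) ≤ -‖z‖ := by nlinarith [norm_nonneg z]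
      have h5 : ‖y‖ ≤ 1 / 2 := by nlinarith
      have h6 : ‖w‖ * ‖y‖ ≤ 1 / 2 := by nlinarith [norm_nonneg u]
      have h7 : 1 ≤ ‖z‖ := by linarith [norm_nonneg u]
      nlinarith

end IsQuadraticallyComparable

/-- If the maximum defining the preconjugate of `‖·‖ ^ 2 + ψ` at `u` is attained at a limit `w` of
points whose segments are controlled by `ψ`, then near-maximizers converge to `w`. -/
theorem IsQuadraticMinorant.norm_sub_lt_of_near_max {ψ : (X →L[ℝ] ℝ) → ℝ}
    (hψ : IsQuadraticMinorant ψ) {w : X →L[ℝ] ℝ}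
    (hw : w ∈ closure {q | ControlsSegment ψ q}) {u : X}
    (hmax : preconjugate (fun z => ‖z‖ ^ 2 + ψ z) u ≤ w u - (‖w‖ ^ 2 + ψ w))
    {ε : ℝ} (hε : 0 < ε) :
    ∃ δ > 0, ∀ z : X →L[ℝ] ℝ, preconjugate (fun z => ‖z‖ ^ 2 + ψ z) u - δ ≤
      z u - (‖z‖ ^ 2 + ψ z) → ‖z - w‖ < ε := by
  obtain ⟨δ, hδ, H⟩ := hψ.norm_sub_lt_of_midDefect hw hε
  refine ⟨δ, hδ, fun z hz => H z ?_⟩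
  have := hψ.sq_add.le_preconjugate u ((1 / 2 : ℝ) • z + (1 / 2 : ℝ) • w)
  simp only [add_apply, smul_apply, smul_eq_mul] at this
  unfold midDefect
  linarith

end Conjugate

section WeakLimits

variable {X : Type*} [NormedAddCommGroup X] [NormedSpace ℝ X]

theorem exists_pointwise_limit_of_norm_le {q : ℕ → X →L[ℝ] ℝ} {B : ℝ}
    (hq : ∀ᶠ n in atTop, ‖q n‖ ≤ B) :
    ∃ w : X →L[ℝ] ℝ, ∀ u, Tendsto (fun n => q n u) (hyperfilter ℕ : Filter ℕ) (𝓝 (w u)) := by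
  have hU : (hyperfilter ℕ : Filter ℕ) ≤ atTop := by
    rw [← Nat.cofinite_eq_atTop]; exact hyperfilter_le_cofinite
  let g : ℕ → WeakDual ℝ X := fun n => StrongDual.toWeakDual (q n)
  obtain ⟨w, -, hw⟩ :=
    (WeakDual.isCompact_closedBall (𝕜 := ℝ) (0 : X →L[ℝ] ℝ) B).ultrafilter_le_nhds
      ((hyperfilter ℕ).map g) (le_principal_iff.2 ((hq.filter_mono hU).mono fun n hn =>
      mem_closedBall_zero_iff.2 hn))
  refine ⟨WeakDual.toStrongDual w, fun u => ?_⟩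
  exact ((WeakDual.eval_continuous u).tendsto w).comp hw

theorem IsReflexiveSpace.mem_of_tendsto (hrefl : IsReflexiveSpace X) {C : Set (X →L[ℝ] ℝ)}
    (hC : Convex ℝ C) (hcl : IsClosed C) {l : Filter ℕ} [l.NeBot] {q : ℕ → X →L[ℝ] ℝ}
    {w : X →L[ℝ] ℝ} (hw : ∀ u, Tendsto (fun n => q n u) l (𝓝 (w u)))
    (hq : ∀ᶠ n in l, q n ∈ C) : w ∈ C := by
  by_contra hwC
  obtain ⟨F, s, h1, h2⟩ := geometric_hahn_banach_closed_point hC hcl hwC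
  obtain ⟨u, rfl⟩ := hrefl F
  simp only [NormedSpace.dual_def] at h1 h2
  exact absurd (le_of_tendsto (hw u) (hq.mono fun n hn => (h1 _ hn).le)) (not_le.2 h2)

end WeakLimits

section History

/-- Dependent choice where each choice may depend on all the previous ones. -/
theorem exists_seq_of_forall_history {α : Type*} [Nonempty α] (P : ℕ → (ℕ → α) → α → Prop)
    (hcongr : ∀ n s t a, (∀ j < n, s j = t j) → P n s a → P n t a)
    (h : ∀ n s, ∃ a, P n s a) : ∃ s : ℕ → α, ∀ n, P n s (s n) := by
  classical
  choose g hg using h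
  let F : ∀ n, (∀ m, m < n → α) → α := fun n ih =>
    g n fun m => if hm : m < n then ih m hm else Classical.arbitrary α
  let s : ℕ → α := fun n => Nat.strongRec F n
  have hs : ∀ n, s n = F n fun m _ => s m := fun n => Nat.strongRec_eq F n
  refine ⟨s, fun n => ?_⟩
  rw [hs n]
  exact hcongr n _ s _ (fun j hj => by simp [hj]) (hg n _)

end History

section PartialSums

variable {E : Type*} [NormedAddCommGroup E]

/-- The squared norm plus a weighted partial sum of functions. -/
noncomputable def partialSqAdd (ψ : ℕ → E → ℝ) (n : ℕ) (z : E) : ℝ :=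
  ‖z‖ ^ 2 + ∑ j ∈ Finset.range n, (1 / 16 : ℝ) ^ (j + 1) * ψ j z

/-- The squared norm plus a weighted series of functions. -/
noncomputable def totalSqAdd (ψ : ℕ → E → ℝ) (z : E) : ℝ :=
  ‖z‖ ^ 2 + ∑' j, (1 / 16 : ℝ) ^ (j + 1) * ψ j z

theorem partialSqAdd_congr {ψ ψ' : ℕ → E → ℝ} {n : ℕ} (h : ∀ j < n, ψ j = ψ' j) :
    partialSqAdd ψ n = partialSqAdd ψ' n := by
  funext z
  unfold partialSqAdd
  congr 1
  exact Finset.sum_congr rfl fun j hj => by rw [h j (Finset.mem_range.1 hj)]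

theorem summable_pow_succ_sixteen : Summable fun j : ℕ => (1 / 16 : ℝ) ^ (j + 1) :=
  (summable_nat_add_iff 1).2 (summable_geometric_of_lt_one (by norm_num) (by norm_num))

theorem tsum_pow_succ_sixteen_add (n : ℕ) :
    ∑' j : ℕ, (1 / 16 : ℝ) ^ (j + n + 1) = (1 / 16) ^ n / 15 := by
  have : ∀ j : ℕ, (1 / 16 : ℝ) ^ (j + n + 1) = (1 / 16) ^ j * ((1 / 16) ^ n / 16) := fun j => by
    rw [pow_succ, pow_add]; ring
  simp_rw [this]
  rw [tsum_mul_right, tsum_geometric_of_lt_one (by norm_num) (by norm_num)]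
  ring

variable [NormedSpace ℝ E] {ψ : ℕ → E → ℝ}

theorem isQuadraticMinorant_series (hψ : ∀ j, IsQuadraticMinorant (ψ j)) :
    IsQuadraticMinorant fun z => ∑' j, (1 / 16 : ℝ) ^ (j + 1) * ψ j z :=
  IsQuadraticMinorant.tsum hψ (fun j => by positivity) summable_pow_succ_sixteen (by
    have := tsum_pow_succ_sixteen_add 0
    norm_num at this ⊢
    linarith)

theorem isQuadraticallyComparable_totalSqAdd (hψ : ∀ j, IsQuadraticMinorant (ψ j)) :
    IsQuadraticallyComparable (totalSqAdd ψ) :=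
  (isQuadraticMinorant_series hψ).sq_add

theorem partialSqAdd_le_succ (hψ : ∀ j, IsQuadraticMinorant (ψ j)) (n : ℕ) (z : E) :
    partialSqAdd ψ n z ≤ partialSqAdd ψ (n + 1) z := by
  unfold partialSqAdd
  rw [Finset.sum_range_succ]
  have := mul_nonneg (by positivity : 0 ≤ (1 / 16 : ℝ) ^ (n + 1)) ((hψ n).nonneg z)
  linarith

theorem partialSqAdd_succ_le (hψ : ∀ j, IsQuadraticMinorant (ψ j)) (n : ℕ) (z : E) :
    partialSqAdd ψ (n + 1) z ≤ partialSqAdd ψ n z + (1 / 16) ^ n * ‖z‖ ^ 2 := by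
  unfold partialSqAdd
  rw [Finset.sum_range_succ]
  have h1 := mul_le_mul_of_nonneg_left ((hψ n).le_sq z)
    (by positivity : 0 ≤ (1 / 16 : ℝ) ^ (n + 1))
  have h2 : (1 / 16 : ℝ) ^ (n + 1) * ‖z‖ ^ 2 ≤ (1 / 16) ^ n * ‖z‖ ^ 2 := by
    refine mul_le_mul_of_nonneg_right ?_ (sq_nonneg _)
    exact pow_le_pow_of_le_one (by norm_num) (by norm_num) n.le_succ
  linarith

theorem totalSqAdd_eq (hψ : ∀ j, IsQuadraticMinorant (ψ j)) (n : ℕ) (z : E) :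
    totalSqAdd ψ z = partialSqAdd ψ n z + ∑' j, (1 / 16 : ℝ) ^ (j + n + 1) * ψ (j + n) z := by
  have hS := IsQuadraticMinorant.summable hψ (fun j => by positivity) summable_pow_succ_sixteen z
  unfold totalSqAdd partialSqAdd
  rw [← hS.sum_add_tsum_nat_add n, add_assoc]

theorem partialSqAdd_le_total (hψ : ∀ j, IsQuadraticMinorant (ψ j)) (n : ℕ) (z : E) :
    partialSqAdd ψ n z ≤ totalSqAdd ψ z := by
  rw [totalSqAdd_eq hψ n z]
  exact le_add_of_nonneg_right
    (tsum_nonneg fun j => mul_nonneg (by positivity) ((hψ _).nonneg z))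

theorem totalSqAdd_le_partial (hψ : ∀ j, IsQuadraticMinorant (ψ j)) (n : ℕ) (z : E) :
    totalSqAdd ψ z ≤ partialSqAdd ψ n z + (1 / 16) ^ n * ‖z‖ ^ 2 := by
  rw [totalSqAdd_eq hψ n z]
  gcongr
  have hs : Summable fun j : ℕ => (1 / 16 : ℝ) ^ (j + n + 1) :=
    (summable_nat_add_iff n).2 summable_pow_succ_sixteen
  have hψn : ∀ j, IsQuadraticMinorant (ψ (j + n)) := fun j => hψ _
  calc ∑' j, (1 / 16 : ℝ) ^ (j + n + 1) * ψ (j + n) z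
      ≤ ∑' j, (1 / 16 : ℝ) ^ (j + n + 1) * ‖z‖ ^ 2 :=
        (IsQuadraticMinorant.summable hψn (fun j => by positivity) hs z).tsum_le_tsum
          (fun j => mul_le_mul_of_nonneg_left ((hψn j).le_sq z) (by positivity)) (hs.mul_right _)
    _ = (1 / 16) ^ n / 15 * ‖z‖ ^ 2 := by rw [tsum_mul_right, tsum_pow_succ_sixteen_add]
    _ ≤ (1 / 16) ^ n * ‖z‖ ^ 2 := by
        refine mul_le_mul_of_nonneg_right (div_le_self (by positivity) (by norm_num)) (sq_nonneg _)

theorem isQuadraticallyComparable_partialSqAdd (hψ : ∀ j, IsQuadraticMinorant (ψ j))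
    (n : ℕ) :
    IsQuadraticallyComparable (partialSqAdd ψ n) where
  convex := by
    refine (convexOn_univ_norm.sq_of_nonneg norm_nonneg).add ?_
    induction n with
    | zero => simpa using convexOn_const (0 : ℝ) convex_univ
    | succ n ih =>
      simp_rw [Finset.sum_range_succ]
      exact ih.add ((hψ n).convex.smul (by positivity))
  sq_le z := le_add_of_nonneg_right
    (Finset.sum_nonneg fun j _ => mul_nonneg (by positivity) ((hψ j).nonneg z))
  le_two_sq z := (partialSqAdd_le_total hψ n z).trans
    ((isQuadraticallyComparable_totalSqAdd hψ).le_two_sq z)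

end PartialSums

section Perturbation

variable {X : Type*} [NormedAddCommGroup X] [NormedSpace ℝ X]

/-- A finite sum of smoothed squared distances to the points of a sequence. -/
noncomputable def partialPerturbation (ψ : ℕ → (X →L[ℝ] ℝ) → ℝ) (x : ℕ → X) (n : ℕ) (y : X) : ℝ :=
  ∑ j ∈ Finset.range n, (1 / 4 : ℝ) ^ j * preconjugate (partialSqAdd ψ n) (y - x j)

/-- A series of smoothed squared distances to the points of a sequence. -/
noncomputable def totalPerturbation (ψ : ℕ → (X →L[ℝ] ℝ) → ℝ) (x : ℕ → X) (y : X) : ℝ :=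
  ∑' j, (1 / 4 : ℝ) ^ j * preconjugate (totalSqAdd ψ) (y - x j)

theorem partialPerturbation_congr {ψ ψ' : ℕ → (X →L[ℝ] ℝ) → ℝ} {x x' : ℕ → X} {n : ℕ}
    (h : ∀ j < n, ψ j = ψ' j) (hx : ∀ j < n, x j = x' j) :
    partialPerturbation ψ x n = partialPerturbation ψ' x' n := by
  funext y
  unfold partialPerturbation
  rw [partialSqAdd_congr h]
  exact Finset.sum_congr rfl fun j hj => by rw [hx j (Finset.mem_range.1 hj)]

/-- A sequence of approximate minimizers of successive perturbations of `f`, together with an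
increasing sequence of finite sets of functionals controlling the perturbations. -/
structure IsPerturbedMinimizingSeq (Ψ : Finset (X →L[ℝ] ℝ) → (X →L[ℝ] ℝ) → ℝ) (f : X → ℝ)
    (S : Set X) (x : ℕ → X) (G : ℕ → Finset (X →L[ℝ] ℝ)) : Prop where
  mem : ∀ n, x n ∈ S
  le_add : ∀ n, ∀ y ∈ S, f (x n) + partialPerturbation (fun j => Ψ (G j)) x n (x n) ≤
    f y + partialPerturbation (fun j => Ψ (G j)) x n y + (1 / 16) ^ n
  mono : ∀ n, ∀ j < n, G j ⊆ G n
  near_max : ∀ n, ∀ i < n, ∃ q ∈ G n,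
    preconjugate (partialSqAdd (fun j => Ψ (G j)) n) (x n - x i) - (1 / 2) ^ n <
      q (x n - x i) - partialSqAdd (fun j => Ψ (G j)) n q

theorem exists_isPerturbedMinimizingSeq {Ψ : Finset (X →L[ℝ] ℝ) → (X →L[ℝ] ℝ) → ℝ}
    (hΨ : ∀ G, IsQuadraticMinorant (Ψ G)) {f : X → ℝ} {S : Set X} {a : X} (ha : a ∈ S)
    (hfa : ∀ y ∈ S, f a ≤ f y + 1) :
    ∃ x G, IsPerturbedMinimizingSeq Ψ f S x G ∧ x 0 = a := by
  classical
  let P : ℕ → (ℕ → X × Finset (X →L[ℝ] ℝ)) → X × Finset (X →L[ℝ] ℝ) → Prop := fun n s p =>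
    p.1 ∈ S ∧ (n = 0 → p.1 = a) ∧
    (∀ y ∈ S, f p.1 + partialPerturbation (fun j => Ψ (s j).2) (fun j => (s j).1) n p.1 ≤
      f y + partialPerturbation (fun j => Ψ (s j).2) (fun j => (s j).1) n y + (1 / 16) ^ n) ∧
    (∀ j < n, (s j).2 ⊆ p.2) ∧
    ∀ i < n, ∃ q ∈ p.2,
      preconjugate (partialSqAdd (fun j => Ψ (s j).2) n) (p.1 - (s i).1) - (1 / 2) ^ n <
        q (p.1 - (s i).1) - partialSqAdd (fun j => Ψ (s j).2) n q
  obtain ⟨s, hs⟩ := exists_seq_of_forall_history P (by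
    rintro n s t p hst ⟨h1, h2, h3, h4, h5⟩
    have e1 : partialSqAdd (fun j => Ψ (s j).2) n = partialSqAdd (fun j => Ψ (t j).2) n :=
      partialSqAdd_congr fun j hj => by rw [hst j hj]
    have e2 : partialPerturbation (fun j => Ψ (s j).2) (fun j => (s j).1) n =
        partialPerturbation (fun j => Ψ (t j).2) (fun j => (t j).1) n :=
      partialPerturbation_congr (fun j hj => by rw [hst j hj]) fun j hj => by rw [hst j hj]
    refine ⟨h1, h2, e2 ▸ h3, fun j hj => hst j hj ▸ h4 j hj, fun i hi => ?_⟩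
    rw [← e1, ← hst i hi]
    exact h5 i hi) (by
    intro n s
    obtain ⟨p, hpS, hp0, hp⟩ : ∃ p ∈ S, (n = 0 → p = a) ∧
        ∀ y ∈ S, f p + partialPerturbation (fun j => Ψ (s j).2) (fun j => (s j).1) n p ≤
          f y + partialPerturbation (fun j => Ψ (s j).2) (fun j => (s j).1) n y +
            (1 / 16) ^ n := by
      rcases Nat.eq_zero_or_pos n with rfl | hn
      · exact ⟨a, ha, fun _ => rfl, fun y hy => by simpa [partialPerturbation] using hfa y hy⟩
      · set g : X → ℝ := fun y =>
          f y + partialPerturbation (fun j => Ψ (s j).2) (fun j => (s j).1) n y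
        have hbdd : BddBelow (g '' S) := by
          refine ⟨f a - 1, ?_⟩
          rintro _ ⟨y, hy, rfl⟩
          have : 0 ≤ partialPerturbation (fun j => Ψ (s j).2) (fun j => (s j).1) n y :=
            Finset.sum_nonneg fun j _ => mul_nonneg (by positivity)
              ((isQuadraticallyComparable_partialSqAdd (fun j => hΨ _) n).preconjugate_nonneg _)
          have := hfa y hy
          simp only [g]
          linarith
        obtain ⟨_, ⟨p, hp, rfl⟩, hlt⟩ := exists_lt_of_csInf_lt ((nonempty_of_mem ha).image g)
          (lt_add_of_pos_right (sInf (g '' S)) (by positivity : (0 : ℝ) < (1 / 16) ^ n))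
        refine ⟨p, hp, fun h => absurd h hn.ne', fun y hy => ?_⟩
        have := csInf_le hbdd (mem_image_of_mem g hy)
        exact hlt.le.trans (by linarith)
    choose q hq using fun i => IsQuadraticallyComparable.exists_lt_apply_sub
      (partialSqAdd (fun j => Ψ (s j).2) n) (p - (s i).1)
      (by positivity : (0 : ℝ) < (1 / 2) ^ n)
    refine ⟨(p, (Finset.range n).image q ∪ (Finset.range n).biUnion fun j => (s j).2),
      hpS, hp0, hp, fun j hj => ?_, fun i hi => ⟨q i, ?_, hq i⟩⟩
    · exact (Finset.subset_biUnion_of_mem (fun j => (s j).2) (Finset.mem_range.2 hj)).trans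
        Finset.subset_union_right
    · exact Finset.mem_union_left _ (Finset.mem_image_of_mem q (Finset.mem_range.2 hi)))
  exact ⟨fun n => (s n).1, fun n => (s n).2, ⟨fun n => (hs n).1, fun n => (hs n).2.2.1,
    fun n => (hs n).2.2.2.1, fun n => (hs n).2.2.2.2⟩, (hs 0).2.1 rfl⟩

end Perturbation

section Limits

variable {X : Type*} [NormedAddCommGroup X] [NormedSpace ℝ X]

theorem hasSum_pow_fourth : HasSum (fun j : ℕ => (1 / 4 : ℝ) ^ j) (4 / 3) := by
  have := hasSum_geometric_of_lt_one (r := (1 / 4 : ℝ)) (by norm_num) (by norm_num)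
  convert this using 1
  norm_num

theorem hasSum_pow_half : HasSum (fun j : ℕ => (1 / 2 : ℝ) ^ j) 2 := by
  have := hasSum_geometric_of_lt_one (r := (1 / 2 : ℝ)) (by norm_num) (by norm_num)
  convert this using 1
  norm_num

theorem IsQuadraticallyComparable.summable_preconjugate {h : (X →L[ℝ] ℝ) → ℝ}
    (hh : IsQuadraticallyComparable h) {u : ℕ → X} {B : ℝ} (hu : ∀ j, ‖u j‖ ≤ B) :
    Summable fun j => (1 / 4 : ℝ) ^ j * preconjugate h (u j) := by
  refine Summable.of_nonneg_of_le
    (fun j => mul_nonneg (by positivity) (hh.preconjugate_nonneg _)) (fun j => ?_)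
    (hasSum_pow_fourth.summable.mul_right (B ^ 2 / 4))
  refine mul_le_mul_of_nonneg_left ((hh.preconjugate_le_sq _).trans ?_) (by positivity)
  linarith [pow_le_pow_left₀ (norm_nonneg _) (hu j) 2]

theorem sum_range_pow_fourth_le (n : ℕ) : ∑ j ∈ Finset.range n, (1 / 4 : ℝ) ^ j ≤ 2 :=
  (hasSum_pow_fourth.summable.sum_le_tsum _ fun j _ => by positivity).trans
    (by rw [hasSum_pow_fourth.tsum_eq]; norm_num)

/-- A weighted series of superdifferentiable preconjugates is superdifferentiable. -/
theorem IsQuadraticallyComparable.exists_tsum_preconjugate_le {h : (X →L[ℝ] ℝ) → ℝ}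
    (hh : IsQuadraticallyComparable h) {u : ℕ → X} (hu : ∀ j, ‖u j‖ ≤ 1)
    {w : ℕ → X →L[ℝ] ℝ} (hw : ∀ j, ‖w j‖ ≤ 2)
    (H : ∀ j, ∀ ε > 0, ∃ δ > 0, ∀ y, ‖y‖ < δ →
      preconjugate h (u j + y) ≤ preconjugate h (u j) + w j y + ε * ‖y‖) :
    ∃ Φ : X →L[ℝ] ℝ, ∀ ε > 0, ∃ δ > 0, ∀ y, ‖y‖ < δ →
      ∑' j, (1 / 4 : ℝ) ^ j * preconjugate h (u j + y) ≤
        ∑' j, (1 / 4 : ℝ) ^ j * preconjugate h (u j) + Φ y + ε * ‖y‖ := by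
  have hwS : Summable fun j => (1 / 4 : ℝ) ^ j • w j := by
    refine Summable.of_norm_bounded (hasSum_pow_fourth.summable.mul_right 2) fun j => ?_
    rw [norm_smul, Real.norm_of_nonneg (by positivity)]
    exact mul_le_mul_of_nonneg_left (hw j) (by positivity)
  refine ⟨∑' j, (1 / 4 : ℝ) ^ j • w j, fun ε hε => ?_⟩
  obtain ⟨m, hm⟩ := exists_pow_lt_of_lt_one (by positivity : 0 < ε / 16)
    (by norm_num : (1 / 2 : ℝ) < 1)
  choose δ hδ Hδ using fun j => H j (ε / 4) (by positivity)
  have hev : ∀ᶠ y : X in 𝓝 0, (∀ j ∈ Finset.range m, ‖y‖ < δ j) ∧ ‖y‖ < 1 := by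
    refine ((Finset.eventually_all _).2 fun j _ => ?_).and ?_
    · filter_upwards [ball_mem_nhds (0 : X) (hδ j)] with y hy using by simpa using hy
    · filter_upwards [ball_mem_nhds (0 : X) one_pos] with y hy using by simpa using hy
  obtain ⟨η, hη, Hη⟩ := Metric.eventually_nhds_iff.1 hev
  refine ⟨η, hη, fun y hy => ?_⟩
  obtain ⟨hy1, hy2⟩ := Hη (by simpa using hy)
  have hwy : HasSum (fun j => (1 / 4 : ℝ) ^ j * w j y) ((∑' j, (1 / 4 : ℝ) ^ j • w j) y) := by
    simpa using hwS.hasSum.mapL (ContinuousLinearMap.apply ℝ ℝ y)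
  have hN := (hh.summable_preconjugate hu).hasSum
  have hN' := (hh.summable_preconjugate (u := fun j => u j + y) (B := 2) fun j =>
    (norm_add_le _ _).trans (by linarith [hu j])).hasSum
  have hE := ((hasSum_pow_fourth.mul_right (ε / 4)).add
    (hasSum_pow_half.mul_right (4 * (1 / 2 : ℝ) ^ m))).mul_right ‖y‖
  refine (hasSum_le (fun j => ?_) hN' ((hN.add hwy).add hE)).trans ?_
  · have key : preconjugate h (u j + y) ≤ preconjugate h (u j) + w j y + ε / 4 * ‖y‖ ∨
        (m ≤ j ∧ preconjugate h (u j + y) ≤ preconjugate h (u j) + w j y + 4 * ‖y‖) := by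
      rcases lt_or_ge j m with hj | hj
      · exact Or.inl (Hδ j y (hy1 j (Finset.mem_range.2 hj)))
      · refine Or.inr ⟨hj, ?_⟩
        have h1 := hh.preconjugate_le_add_norm_sub (u j + y) (u j)
        rw [add_sub_cancel_left] at h1
        have h2 := (neg_le_abs _).trans ((w j).le_opNorm y)
        have h3 := mul_le_mul_of_nonneg_right (hw j) (norm_nonneg y)
        have h4 : ‖u j + y‖ ≤ 2 := (norm_add_le _ _).trans (by linarith [hu j])
        have h5 := mul_le_mul_of_nonneg_left h4 (norm_nonneg y)
        linarith
    have hp : 0 < (1 / 4 : ℝ) ^ j := by positivity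
    have hq : 0 ≤ (1 / 2 : ℝ) ^ j * (4 * (1 / 2) ^ m) * ‖y‖ := by positivity
    rcases key with h1 | ⟨hj, h1⟩
    · have := mul_le_mul_of_nonneg_left h1 hp.le
      linarith
    · have h2 := mul_le_mul_of_nonneg_left h1 hp.le
      have h3 : (1 / 4 : ℝ) ^ j ≤ (1 / 2) ^ j * (1 / 2) ^ m := by
        rw [show (1 / 4 : ℝ) = 1 / 2 * (1 / 2) by norm_num, mul_pow]
        exact mul_le_mul_of_nonneg_left
          (pow_le_pow_of_le_one (by norm_num) (by norm_num) hj) (by positivity)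
      have h4 := mul_le_mul_of_nonneg_right h3 (by positivity : 0 ≤ 4 * ‖y‖)
      have h5 : 0 ≤ (1 / 4 : ℝ) ^ j * (ε / 4) * ‖y‖ := by positivity
      linarith
  · have := mul_le_mul_of_nonneg_right hm.le (norm_nonneg y)
    have h0 := mul_nonneg hε.le (norm_nonneg y)
    linarith

namespace IsPerturbedMinimizingSeq

variable {Ψ : Finset (X →L[ℝ] ℝ) → (X →L[ℝ] ℝ) → ℝ} {f : X → ℝ} {S : Set X} {x : ℕ → X}
  {G : ℕ → Finset (X →L[ℝ] ℝ)}

theorem preconjugate_partial_le_total (hΨ : ∀ G, IsQuadraticMinorant (Ψ G)) (n : ℕ) {u : X}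
    (hu : ‖u‖ ≤ 1) : preconjugate (partialSqAdd (fun j => Ψ (G j)) n) u ≤
      preconjugate (totalSqAdd fun j => Ψ (G j)) u + (1 / 16) ^ n := by
  refine ((isQuadraticallyComparable_partialSqAdd (fun j => hΨ (G j)) n).preconjugate_le_add
    (isQuadraticallyComparable_totalSqAdd fun j => hΨ (G j)) (by positivity)
    (totalSqAdd_le_partial (fun j => hΨ (G j)) n) u).trans ?_
  gcongr
  exact mul_le_of_le_one_right (by positivity) (pow_le_one₀ (norm_nonneg u) hu)

theorem preconjugate_partial_le_succ (hΨ : ∀ G, IsQuadraticMinorant (Ψ G)) (n : ℕ) {u : X}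
    (hu : ‖u‖ ≤ 1) : preconjugate (partialSqAdd (fun j => Ψ (G j)) n) u ≤
      preconjugate (partialSqAdd (fun j => Ψ (G j)) (n + 1)) u + (1 / 16) ^ n := by
  refine ((isQuadraticallyComparable_partialSqAdd (fun j => hΨ (G j)) n).preconjugate_le_add
    (isQuadraticallyComparable_partialSqAdd (fun j => hΨ (G j)) (n + 1)) (by positivity)
    (partialSqAdd_succ_le (fun j => hΨ (G j)) n) u).trans ?_
  gcongr
  exact mul_le_of_le_one_right (by positivity) (pow_le_one₀ (norm_nonneg u) hu)

theorem norm_sub_succ_le (hΨ : ∀ G, IsQuadraticMinorant (Ψ G))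
    (hS : ∀ y ∈ S, ∀ z ∈ S, ‖y - z‖ ≤ 1) (h : IsPerturbedMinimizingSeq Ψ f S x G) (n : ℕ) :
    ‖x n - x (n + 1)‖ ≤ 6 * (1 / 2) ^ n := by
  have hc := fun n => isQuadraticallyComparable_partialSqAdd (fun j => hΨ (G j)) n
  have h1 := h.le_add (n + 1) (x n) (h.mem n)
  have h2 := h.le_add n (x (n + 1)) (h.mem (n + 1))
  have h3 : partialPerturbation (fun j => Ψ (G j)) x (n + 1) (x n) ≤
      partialPerturbation (fun j => Ψ (G j)) x n (x n) := by
    unfold partialPerturbation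
    rw [Finset.sum_range_succ, sub_self, (hc (n + 1)).preconjugate_zero, mul_zero, add_zero]
    gcongr
    exact (hc n).preconjugate_anti (partialSqAdd_le_succ (fun j => hΨ (G j)) n) _
  have h4 : partialPerturbation (fun j => Ψ (G j)) x n (x (n + 1)) +
      (1 / 4) ^ n * (‖x n - x (n + 1)‖ ^ 2 / 8) ≤
      partialPerturbation (fun j => Ψ (G j)) x (n + 1) (x (n + 1)) + 2 * (1 / 16) ^ n := by
    have h5 : partialPerturbation (fun j => Ψ (G j)) x n (x (n + 1)) ≤
        ∑ j ∈ Finset.range n, (1 / 4 : ℝ) ^ j *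
          preconjugate (partialSqAdd (fun j => Ψ (G j)) (n + 1)) (x (n + 1) - x j) +
        2 * (1 / 16) ^ n := by
      refine (Finset.sum_le_sum fun j _ => mul_le_mul_of_nonneg_left
        (preconjugate_partial_le_succ hΨ n (hS _ (h.mem (n + 1)) _ (h.mem j)))
        (by positivity)).trans ?_
      simp_rw [mul_add]
      rw [Finset.sum_add_distrib, ← Finset.sum_mul]
      gcongr
      exact sum_range_pow_fourth_le n
    have h6 : partialPerturbation (fun j => Ψ (G j)) x (n + 1) (x (n + 1)) =
        ∑ j ∈ Finset.range n, (1 / 4 : ℝ) ^ j *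
          preconjugate (partialSqAdd (fun j => Ψ (G j)) (n + 1)) (x (n + 1) - x j) +
        (1 / 4) ^ n * preconjugate (partialSqAdd (fun j => Ψ (G j)) (n + 1))
          (x (n + 1) - x n) := Finset.sum_range_succ _ _
    have h7 := mul_le_mul_of_nonneg_left ((hc (n + 1)).sq_le_preconjugate (x (n + 1) - x n))
      (by positivity : 0 ≤ (1 / 4 : ℝ) ^ n)
    rw [norm_sub_rev] at h7
    linarith
  have h5 : (1 / 16 : ℝ) ^ (n + 1) ≤ (1 / 16) ^ n :=
    pow_le_pow_of_le_one (by norm_num) (by norm_num) n.le_succ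
  have h6 : (1 / 16 : ℝ) ^ n = (1 / 4) ^ n * (1 / 4) ^ n := by
    rw [← mul_pow]; norm_num
  have h7 : (1 / 4 : ℝ) ^ n * (‖x n - x (n + 1)‖ ^ 2 / 8) ≤ (1 / 4) ^ n * (4 * (1 / 4) ^ n) := by
    linarith
  have h8 := le_of_mul_le_mul_left h7 (by positivity)
  have h9 : (1 / 4 : ℝ) ^ n = (1 / 2) ^ n * (1 / 2) ^ n := by
    rw [← mul_pow]; norm_num
  refine le_of_sq_le_sq ?_ (by positivity)
  nlinarith [sq_nonneg ((1 / 2 : ℝ) ^ n)]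

theorem totalPerturbation_le_partial (hΨ : ∀ G, IsQuadraticMinorant (Ψ G))
    (hS : ∀ y ∈ S, ∀ z ∈ S, ‖y - z‖ ≤ 1) (h : IsPerturbedMinimizingSeq Ψ f S x G) (n : ℕ)
    {y : X} (hy : y ∈ S) : totalPerturbation (fun j => Ψ (G j)) x y ≤
      partialPerturbation (fun j => Ψ (G j)) x n y + 2 * (1 / 4) ^ n := by
  have hc := isQuadraticallyComparable_totalSqAdd fun j => hΨ (G j)
  have hs := hc.summable_preconjugate (u := fun j => y - x j) fun j => hS y hy _ (h.mem j)
  unfold totalPerturbation partialPerturbation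
  rw [← hs.sum_add_tsum_nat_add n]
  have htail := hasSum_pow_fourth.mul_right ((1 / 4 : ℝ) ^ n)
  refine add_le_add (Finset.sum_le_sum fun j _ => mul_le_mul_of_nonneg_left
    ((isQuadraticallyComparable_partialSqAdd (fun j => hΨ (G j)) n).preconjugate_anti
      (partialSqAdd_le_total (fun j => hΨ (G j)) n) _) (by positivity))
    ((hasSum_le (fun j => ?_) ((summable_nat_add_iff n).2 hs).hasSum htail).trans ?_)
  · rw [← pow_add]
    refine mul_le_of_le_one_right (by positivity) ((hc.preconjugate_le_sq _).trans ?_)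
    have := pow_le_one₀ (norm_nonneg _) (hS y hy _ (h.mem (j + n))) (n := 2)
    linarith
  · gcongr
    norm_num

theorem partialPerturbation_le_total (hΨ : ∀ G, IsQuadraticMinorant (Ψ G))
    (hS : ∀ y ∈ S, ∀ z ∈ S, ‖y - z‖ ≤ 1) (h : IsPerturbedMinimizingSeq Ψ f S x G) (n : ℕ)
    {y : X} (hy : y ∈ S) : partialPerturbation (fun j => Ψ (G j)) x n y ≤
      totalPerturbation (fun j => Ψ (G j)) x y + 2 * (1 / 16) ^ n := by
  have hc := isQuadraticallyComparable_totalSqAdd fun j => hΨ (G j)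
  have hs := hc.summable_preconjugate (u := fun j => y - x j) fun j => hS y hy _ (h.mem j)
  refine (Finset.sum_le_sum fun j _ => mul_le_mul_of_nonneg_left
    (preconjugate_partial_le_total hΨ n (hS _ hy _ (h.mem j))) (by positivity)).trans ?_
  simp_rw [mul_add]
  rw [Finset.sum_add_distrib, ← Finset.sum_mul]
  gcongr
  · exact hs.sum_le_tsum _ fun j _ => mul_nonneg (by positivity) (hc.preconjugate_nonneg _)
  · exact sum_range_pow_fourth_le n

theorem totalPerturbation_le_add (hΨ : ∀ G, IsQuadraticMinorant (Ψ G))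
    (hS : ∀ y ∈ S, ∀ z ∈ S, ‖y - z‖ ≤ 1) (h : IsPerturbedMinimizingSeq Ψ f S x G)
    {y z : X} (hy : y ∈ S) (hz : z ∈ S) : totalPerturbation (fun j => Ψ (G j)) x y ≤
      totalPerturbation (fun j => Ψ (G j)) x z + 2 * ‖y - z‖ := by
  have hc := isQuadraticallyComparable_totalSqAdd fun j => hΨ (G j)
  have hsy := hc.summable_preconjugate (u := fun j => y - x j) fun j => hS y hy _ (h.mem j)
  have hsz := hc.summable_preconjugate (u := fun j => z - x j) fun j => hS z hz _ (h.mem j)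
  refine (hasSum_le (fun j => ?_) hsy.hasSum
    (hsz.hasSum.add (hasSum_pow_fourth.mul_right ‖y - z‖))).trans ?_
  · rw [← mul_add]
    refine mul_le_mul_of_nonneg_left ((hc.preconjugate_le_add_norm_sub _ (z - x j)).trans ?_)
      (by positivity)
    rw [sub_sub_sub_cancel_right]
    gcongr
    exact mul_le_of_le_one_right (norm_nonneg _) (hS y hy _ (h.mem j))
  · unfold totalPerturbation
    gcongr
    norm_num

/-- A limit of a perturbed minimizing sequence minimizes the total perturbation. -/
theorem add_totalPerturbation_le (hΨ : ∀ G, IsQuadraticMinorant (Ψ G))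
    (hS : ∀ y ∈ S, ∀ z ∈ S, ‖y - z‖ ≤ 1) (h : IsPerturbedMinimizingSeq Ψ f S x G)
    (hf : LowerSemicontinuous f) {a : X} (ha : a ∈ S) (hx : Tendsto x atTop (𝓝 a))
    {y : X} (hy : y ∈ S) : f a + totalPerturbation (fun j => Ψ (G j)) x a ≤
      f y + totalPerturbation (fun j => Ψ (G j)) x y := by
  refine le_of_forall_pos_le_add fun ε hε => ?_
  have ht : Tendsto (fun n => 3 * (1 / 16 : ℝ) ^ n + 2 * (1 / 4) ^ n + 2 * ‖a - x n‖) atTop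
      (𝓝 (3 * 0 + 2 * 0 + 2 * ‖a - a‖)) :=
    (((tendsto_pow_atTop_nhds_zero_of_lt_one (by norm_num) (by norm_num)).const_mul 3).add
      ((tendsto_pow_atTop_nhds_zero_of_lt_one (by norm_num) (by norm_num)).const_mul 2)).add
      ((tendsto_const_nhds.sub hx).norm.const_mul 2)
  have h1 : ∀ᶠ n in atTop, f a - ε / 2 < f (x n) :=
    hx.eventually (hf a (f a - ε / 2) (by linarith))
  obtain ⟨n, hn1, hn2⟩ := (h1.and (ht.eventually_lt_const
    (by simpa using half_pos hε : 3 * 0 + 2 * 0 + 2 * ‖a - a‖ < ε / 2))).exists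
  have h2 := h.le_add n y hy
  have h3 := h.partialPerturbation_le_total hΨ hS n hy
  have h4 := h.totalPerturbation_le_partial hΨ hS n (h.mem n)
  have h5 := h.totalPerturbation_le_add hΨ hS ha (h.mem n)
  linarith

/-- The maximum defining the preconjugate at the increments of the limit is attained in the closed
linear span of the chosen functionals. -/
theorem exists_max_mem_closure (hrefl : IsReflexiveSpace X)
    (hΨ : ∀ G, IsQuadraticMinorant (Ψ G)) (hS : ∀ y ∈ S, ∀ z ∈ S, ‖y - z‖ ≤ 1)
    (h : IsPerturbedMinimizingSeq Ψ f S x G) {a : X} (ha : a ∈ S)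
    (hx : Tendsto x atTop (𝓝 a)) (i : ℕ) :
    ∃ w ∈ closure (⋃ n, (Submodule.span ℝ (G n : Set (X →L[ℝ] ℝ)) : Set (X →L[ℝ] ℝ))),
      preconjugate (totalSqAdd fun j => Ψ (G j)) (a - x i) ≤
        w (a - x i) - totalSqAdd (fun j => Ψ (G j)) w := by
  have hc := isQuadraticallyComparable_totalSqAdd fun j => hΨ (G j)
  have hcn := fun n => isQuadraticallyComparable_partialSqAdd (fun j => hΨ (G j)) n
  choose! q hqG hq using fun n (hn : i < n) => h.near_max n i hn
  have hqn : ∀ n, i < n → ‖q n‖ ≤ 2 := fun n hn => by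
    have h1 : (1 / 2 : ℝ) ^ n ≤ 1 := pow_le_one₀ (by norm_num) (by norm_num)
    have := (hcn n).norm_le_of_preconjugate_sub_lt
      ((sub_le_sub_left h1 _).trans_lt (hq n hn))
    linarith [hS _ (h.mem n) _ (h.mem i)]
  obtain ⟨w, hw⟩ := exists_pointwise_limit_of_norm_le
    ((eventually_gt_atTop i).mono fun n hn => hqn n hn)
  have hU : (hyperfilter ℕ : Filter ℕ) ≤ atTop := by
    rw [← Nat.cofinite_eq_atTop]; exact hyperfilter_le_cofinite
  have hmono : Monotone G := fun m n hmn => by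
    rcases hmn.eq_or_lt with rfl | hlt
    · exact subset_rfl
    · exact h.mono n m hlt
  have hdir : Directed (· ≤ ·) fun n => Submodule.span ℝ (G n : Set (X →L[ℝ] ℝ)) :=
    Monotone.directed_le fun m n hmn => Submodule.span_mono (Finset.coe_subset.2 (hmono hmn))
  refine ⟨w, ?_, le_of_forall_lt fun t ht => ?_⟩
  · rw [← Submodule.coe_iSup_of_directed _ hdir]
    refine hrefl.mem_of_tendsto (Submodule.convex _).closure isClosed_closure hw
      (((eventually_gt_atTop i).filter_mono hU).mono fun n hn => subset_closure ?_)
    exact Submodule.mem_iSup_of_mem n (Submodule.subset_span (hqG n hn))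
  · obtain ⟨s, hts, hs⟩ := exists_between ht
    refine hts.trans_le ?_
    have hlin : ConvexOn ℝ univ fun z : X →L[ℝ] ℝ => -z (a - x i) :=
      ⟨convex_univ, fun z _ z' _ b c _ _ _ => le_of_eq (by
        simp only [add_apply, smul_apply, smul_eq_mul]; ring)⟩
    have hC : Convex ℝ {z : X →L[ℝ] ℝ | totalSqAdd (fun j => Ψ (G j)) z + -z (a - x i) ≤ -s} := by
      simpa using (hc.convex.add hlin).convex_le (-s)
    have hcl : IsClosed {z : X →L[ℝ] ℝ | totalSqAdd (fun j => Ψ (G j)) z + -z (a - x i) ≤ -s} :=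
      isClosed_le (hc.continuous.add
        (ContinuousLinearMap.apply ℝ ℝ (a - x i)).continuous.neg) continuous_const
    have hlim : Tendsto (fun n => (1 / 2 : ℝ) ^ n + 4 * (1 / 16) ^ n + 3 * ‖a - x n‖) atTop
        (𝓝 (0 + 4 * 0 + 3 * ‖a - a‖)) :=
      ((tendsto_pow_atTop_nhds_zero_of_lt_one (by norm_num) (by norm_num)).add
        ((tendsto_pow_atTop_nhds_zero_of_lt_one (by norm_num) (by norm_num)).const_mul 4)).add
        ((tendsto_const_nhds.sub hx).norm.const_mul 3)
    have hev := (hlim.eventually_lt_const (u := preconjugate (totalSqAdd fun j => Ψ (G j))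
      (a - x i) - s) (by simpa using hs)).and (eventually_gt_atTop i)
    have := hrefl.mem_of_tendsto hC hcl hw ((hev.filter_mono hU).mono fun n ⟨hn, hin⟩ => ?_)
    · simp only [mem_ofPred_eq] at this
      linarith
    · have h1 := hq n hin
      have h2 := totalSqAdd_le_partial (fun j => hΨ (G j)) n (q n)
      have h3 := mul_le_mul_of_nonneg_left (pow_le_pow_left₀ (norm_nonneg _) (hqn n hin) 2)
        (by positivity : 0 ≤ (1 / 16 : ℝ) ^ n)
      have h4 := (hcn n).preconjugate_anti (partialSqAdd_le_total (fun j => hΨ (G j)) n)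
        (x n - x i)
      have h5 := hc.preconjugate_le_add_norm_sub (a - x i) (x n - x i)
      rw [sub_sub_sub_cancel_right] at h5
      have h6 := mul_le_of_le_one_right (norm_nonneg (a - x n)) (hS a ha _ (h.mem i))
      have h7 : q n (x n - x i) - q n (a - x i) ≤ 2 * ‖a - x n‖ := by
        rw [← map_sub, sub_sub_sub_cancel_right, norm_sub_rev]
        exact (le_abs_self _).trans (((q n).le_opNorm _).trans
          (mul_le_mul_of_nonneg_right (hqn n hin) (norm_nonneg _)))
      simp only [mem_ofPred_eq]
      linarith

/-- The total perturbation is superdifferentiable at a limit of the sequence. -/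
theorem exists_totalPerturbation_le (hrefl : IsReflexiveSpace X)
    (hΨ : ∀ G, IsQuadraticMinorant (Ψ G))
    (hspan : ∀ G : Finset (X →L[ℝ] ℝ), (Submodule.span ℝ (G : Set (X →L[ℝ] ℝ)) :
      Set (X →L[ℝ] ℝ)) ⊆ closure {q | ControlsSegment (Ψ G) q})
    (hS : ∀ y ∈ S, ∀ z ∈ S, ‖y - z‖ ≤ 1)
    (h : IsPerturbedMinimizingSeq Ψ f S x G) {a : X} (ha : a ∈ S)
    (hx : Tendsto x atTop (𝓝 a)) :
    ∃ Φ : X →L[ℝ] ℝ, ∀ ε > 0, ∃ δ > 0, ∀ y, ‖y‖ < δ →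
      totalPerturbation (fun j => Ψ (G j)) x (a + y) ≤
        totalPerturbation (fun j => Ψ (G j)) x a + Φ y + ε * ‖y‖ := by
  have hc := isQuadraticallyComparable_totalSqAdd fun j => hΨ (G j)
  choose w hw hmax using h.exists_max_mem_closure hrefl hΨ hS ha hx
  have hu : ∀ j, ‖a - x j‖ ≤ 1 := fun j => hS a ha _ (h.mem j)
  have hw' : ∀ j, w j ∈ closure {q | ControlsSegment
      (fun z => ∑' j, (1 / 16 : ℝ) ^ (j + 1) * Ψ (G j) z) q} := fun j => by
    refine closure_minimal (iUnion_subset fun n => (hspan (G n)).trans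
      (closure_mono fun q hq => ?_)) isClosed_closure (hw j)
    exact ControlsSegment.tsum (fun j => hΨ (G j)) (fun j => by positivity)
      summable_pow_succ_sixteen (by positivity) hq
  have := hc.exists_tsum_preconjugate_le hu (w := w) (fun j => ?_) fun j ε hε =>
    hc.preconjugate_add_le (fun ε hε =>
      (isQuadraticMinorant_series fun j => hΨ (G j)).norm_sub_lt_of_near_max
        (hw' j) (hmax j) hε) hε
  · simpa only [totalPerturbation, sub_add_eq_add_sub] using this
  · linarith [hc.norm_le_of_preconjugate_sub_lt ((sub_one_lt _).trans_le (hmax j)), hu j]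

end IsPerturbedMinimizingSeq

end Limits

section Subdifferentiability

variable {X : Type*} [NormedAddCommGroup X] [NormedSpace ℝ X]

/-- A lower semicontinuous function has a Fréchet subgradient in every small ball at whose centre
it is almost minimal. -/
theorem exists_frechetSubdiff_nonempty_of_almost_min [CompleteSpace X]
    (hrefl : IsReflexiveSpace X) {f : X → ℝ} (hf : LowerSemicontinuous f) {a : X} {r : ℝ}
    (hr : 0 < r) (hr1 : r ≤ 1 / 2)
    (hfa : ∀ y ∈ closedBall a r, f a ≤ f y + r ^ 2 / 32) :
    ∃ b ∈ ball a r, (FrechetSubdiff f b).Nonempty := by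
  have hex : ∀ G : Finset (X →L[ℝ] ℝ), ∃ ψ : (X →L[ℝ] ℝ) → ℝ, IsQuadraticMinorant ψ ∧
      (Submodule.span ℝ (G : Set (X →L[ℝ] ℝ)) : Set (X →L[ℝ] ℝ)) ⊆
        closure {q | ControlsSegment ψ q} := fun G =>
    exists_isQuadraticMinorant_controlsSegment G.countable_toSet.isSeparable.span
  choose Ψ hΨ hspan using hex
  have hS : ∀ y ∈ closedBall a r, ∀ z ∈ closedBall a r, ‖y - z‖ ≤ 1 := fun y hy z hz => by
    rw [← dist_eq_norm]
    linarith [dist_triangle_right y z a, mem_closedBall.1 hy, mem_closedBall.1 hz]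
  obtain ⟨x, G, h, hx0⟩ := exists_isPerturbedMinimizingSeq hΨ (mem_closedBall_self hr.le)
    (fun y hy => (hfa y hy).trans (by nlinarith))
  obtain ⟨b, hb⟩ := cauchySeq_tendsto_of_complete (cauchySeq_of_le_geometric (1 / 2) 6
    (by norm_num) fun n => (dist_eq_norm (x n) _).trans_le (h.norm_sub_succ_le hΨ hS n))
  have hbS : b ∈ closedBall a r := isClosed_closedBall.mem_of_tendsto hb
    (Eventually.of_forall h.mem)
  have hmin := fun y hy => h.add_totalPerturbation_le hΨ hS hf hbS hb (y := y) hy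
  have hball : b ∈ ball a r := by
    have hc := isQuadraticallyComparable_totalSqAdd fun j => hΨ (G j)
    have hle : ∀ y ∈ closedBall a r, ∀ j, ‖y - x j‖ ≤ 1 := fun y hy j => hS y hy _ (h.mem j)
    have h1 : ‖b - a‖ ^ 2 / 8 ≤ totalPerturbation (fun j => Ψ (G j)) x b := by
      have := (hc.summable_preconjugate (hle b hbS)).le_tsum 0
        fun j _ => mul_nonneg (by positivity) (hc.preconjugate_nonneg _)
      rw [pow_zero, one_mul, hx0] at this
      exact (hc.sq_le_preconjugate _).trans this
    have h2 : totalPerturbation (fun j => Ψ (G j)) x a ≤ 1 / 3 * (r ^ 2 / 4) := by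
      have hs := hc.summable_preconjugate (hle a (mem_closedBall_self hr.le))
      have hg : HasSum (fun j : ℕ => (1 / 4 : ℝ) ^ (j + 1) * (r ^ 2 / 4))
          (1 / 3 * (r ^ 2 / 4)) := by
        have := (hasSum_pow_fourth.mul_right (1 / 4)).mul_right (r ^ 2 / 4)
        simp_rw [← pow_succ] at this
        rwa [show (4 / 3 * (1 / 4) : ℝ) = 1 / 3 by norm_num] at this
      unfold totalPerturbation
      rw [hs.tsum_eq_zero_add, hx0, sub_self, hc.preconjugate_zero, mul_zero, zero_add]
      refine hasSum_le (fun j => ?_) ((summable_nat_add_iff 1).2 hs).hasSum hg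
      refine mul_le_mul_of_nonneg_left ((hc.preconjugate_le_sq _).trans ?_) (by positivity)
      have := mem_closedBall'.1 (h.mem (j + 1))
      rw [dist_eq_norm] at this
      linarith [pow_le_pow_left₀ (norm_nonneg _) this 2]
    have h3 := hmin a (mem_closedBall_self hr.le)
    have h4 := hfa b hbS
    rw [mem_ball, dist_eq_norm]
    refine lt_of_pow_lt_pow_left₀ 2 hr.le ?_
    nlinarith
  refine ⟨b, hball, ?_⟩
  obtain ⟨Φ, hΦ⟩ := h.exists_totalPerturbation_le hrefl hΨ hspan hS hbS hb
  refine ⟨-Φ, fun ε hε => ?_⟩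
  obtain ⟨δ, hδ, H⟩ := hΦ ε hε
  refine ⟨min δ (r - dist b a), lt_min hδ (sub_pos.2 hball), fun y hy => ?_⟩
  have h1 := H y (hy.trans_le (min_le_left _ _))
  have h2 := hmin (b + y) (by
    have := hy.trans_le (min_le_right _ _)
    have h3 : dist (b + y) a ≤ ‖y‖ + dist b a := by
      simpa using dist_triangle (b + y) b a
    rw [mem_closedBall]
    linarith)
  simp only [neg_apply]
  linarith

theorem FrechetSubdiff.nonempty_of_const_mul {f : X → ℝ} {c : ℝ} (hc : 0 < c) {x : X}
    (h : (FrechetSubdiff (fun y => c * f y) x).Nonempty) : (FrechetSubdiff f x).Nonempty := by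
  obtain ⟨φ, hφ⟩ := h
  refine ⟨c⁻¹ • φ, fun ε hε => ?_⟩
  obtain ⟨δ, hδ, H⟩ := hφ (c * ε) (by positivity)
  refine ⟨δ, hδ, fun y hy => le_of_mul_le_mul_left ?_ hc⟩
  have := H y hy
  simp only [smul_apply, smul_eq_mul]
  rw [mul_sub, mul_inv_cancel_left₀ hc.ne']
  linarith

end Subdifferentiability

/-- If `X` is a reflexive real Banach space and `f : X → ℝ` is lower semicontinuous, then
the set of points at which `f` is Fréchet sub-differentiable is dense in `X`. -/
theorem dense_frechetSubdifferentiable_of_lsc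
    (X : Type*) [NormedAddCommGroup X] [NormedSpace ℝ X] [CompleteSpace X]
    (hrefl : IsReflexiveSpace X)
    (f : X → ℝ) (hf : LowerSemicontinuous f) :
    Dense {x : X | (FrechetSubdiff f x).Nonempty} := by
  refine Metric.dense_iff.2 fun a ρ hρ => ?_
  obtain ⟨ρ', hρ', hlow⟩ := Metric.eventually_nhds_iff.1 (hf a (f a - 1) (by linarith))
  set r := min (min (ρ / 2) (ρ' / 2)) (1 / 2) with hr_def
  have hr : 0 < r := by positivity
  have hrρ : r < ρ := by
    have : r ≤ ρ / 2 := (min_le_left _ _).trans (min_le_left _ _)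
    linarith
  have hrρ' : r < ρ' := by
    have : r ≤ ρ' / 2 := (min_le_left _ _).trans (min_le_right _ _)
    linarith
  have hc : 0 < r ^ 2 / 32 := by positivity
  have hcf : LowerSemicontinuous fun y => r ^ 2 / 32 * f y := fun x t ht => by
    have ht' : t / (r ^ 2 / 32) < f x := (div_lt_iff₀' hc).2 ht
    exact (hf x _ ht').mono fun y hy => (div_lt_iff₀' hc).1 hy
  obtain ⟨b, hb, hsub⟩ := exists_frechetSubdiff_nonempty_of_almost_min hrefl hcf hr
    (min_le_right _ _) (a := a) (fun y hy => by
      have := hlow ((mem_closedBall.1 hy).trans_lt hrρ')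
      nlinarith)
  exact ⟨b, ball_subset_ball hrρ.le hb, FrechetSubdiff.nonempty_of_const_mul hc hsub⟩
end
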